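/- arXiv:2402.14493 — 3 statements merged into one kernel-verified Lean document; each statement's English description precedes it below -/
import Mathlib

section
/- There exists a constant C > 0 such that the following holds. Let u ≥ 1 be an integer and let A_1, …, A_ℓ be nonempty subsets of [1, u]. Let f assign a natural number f(A_i) to each i, let ρ ≥ 1 be a real, and let u' ≥ u be an integer with u' ≥ 2. If Σ_{i=1}^ℓ |A_i| ≥ ℓ + 4Cρu'·log u', then there is a nonempty set of indices I ⊆ {1, …, ℓ} such that the sumset Σ_{i∈I} A_i contains an arithmetic progression of length at least u' with common difference at least 1, and Σ_{i∈I} f(A_i) ≤ (1/ρ)·Σ_{i=1}^ℓ f(A_i). -/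
open Pointwise

/-- In a finite abelian group generated by `A ∋ 0`, any nonempty `X` with `X + A ≠ G` satisfies
`|X + A| ≥ |X| + |A| / 2`. -/
theorem card_add_two_mul_card_le_of_closure_eq_top {G : Type*} [AddCommGroup G] [Fintype G]
    [DecidableEq G] {A : Finset G} (h0 : 0 ∈ A) (hA : AddSubgroup.closure (A : Set G) = ⊤)
    {X : Finset G} (hX : X.Nonempty) (hXA : X + A ≠ Finset.univ) :
    A.card + 2 * X.card ≤ 2 * (X + A).card := by
  classical
  have sub : ∀ Y : Finset G, Y.card ≤ (Y + A).card := fun Y =>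
    Finset.card_le_card (fun y hy => by simpa using Finset.add_mem_add hy h0)
  -- the minimal boundary size
  obtain ⟨κ, ⟨K, hK, hKA, hKκ⟩, hκ⟩ : ∃ κ, (∃ Y : Finset G, Y.Nonempty ∧ Y + A ≠ Finset.univ ∧
      (Y + A).card = Y.card + κ) ∧ ∀ Y : Finset G, Y.Nonempty → Y + A ≠ Finset.univ →
      Y.card + κ ≤ (Y + A).card := by
    have hex : ∃ κ, ∃ Y : Finset G, Y.Nonempty ∧ Y + A ≠ Finset.univ ∧
        (Y + A).card = Y.card + κ :=
      ⟨_, X, hX, hXA, (Nat.add_sub_cancel' (sub X)).symm⟩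
    refine ⟨Nat.find hex, Nat.find_spec hex, fun Y hY hYA => ?_⟩
    have := Nat.find_min' hex ⟨Y, hY, hYA, (Nat.add_sub_cancel' (sub Y)).symm⟩
    have := sub Y
    omega
  -- an atom containing zero
  obtain ⟨M, hM0, hMA, hMκ, hmin⟩ : ∃ M : Finset G, 0 ∈ M ∧ M + A ≠ Finset.univ ∧
      (M + A).card = M.card + κ ∧ ∀ Y : Finset G, Y.Nonempty → Y + A ≠ Finset.univ →
      (Y + A).card = Y.card + κ → M.card ≤ Y.card := by
    have hex : ∃ m, ∃ Y : Finset G, (Y.Nonempty ∧ Y + A ≠ Finset.univ ∧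
        (Y + A).card = Y.card + κ) ∧ Y.card = m := ⟨_, K, ⟨hK, hKA, hKκ⟩, rfl⟩
    obtain ⟨Y, ⟨⟨y, hy⟩, hYA, hYκ⟩, hYm⟩ := Nat.find_spec hex
    refine ⟨{-y} + Y, ?_, ?_, ?_, ?_⟩
    · exact Finset.mem_add.2 ⟨-y, by simp, y, hy, by simp⟩
    · intro h
      apply hYA
      rw [← Finset.card_eq_iff_eq_univ] at h ⊢
      rwa [add_assoc, Finset.card_singleton_add] at h
    · rw [add_assoc, Finset.card_singleton_add, Finset.card_singleton_add, hYκ]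
    · intro Z hZ hZA hZκ
      rw [Finset.card_singleton_add, hYm]
      exact Nat.find_min' hex ⟨Z, ⟨hZ, hZA, hZκ⟩, rfl⟩
  have htrans : ∀ g : G, (M ∩ ({g} + M)).Nonempty → {g} + M = M := by
    intro g hne
    by_contra hgM
    set F : Finset G := {g} + M with hF
    have hFc : F.card = M.card := Finset.card_singleton_add _ _
    have hFA : (F + A).card = M.card + κ := by
      rw [hF, add_assoc, Finset.card_singleton_add, hMκ]
    have hI : (M ∩ F).card < M.card := by
      refine Finset.card_lt_card ((Finset.inter_subset_left).ssubset_of_ne fun h => hgM ?_)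
      exact (Finset.eq_of_subset_of_card_le (Finset.inter_eq_left.1 h) hFc.le).symm
    have hIA : M ∩ F + A ≠ Finset.univ := fun h => hMA <|
      Finset.univ_subset_iff.1 (h ▸ Finset.add_subset_add_right Finset.inter_subset_left)
    have h1 : (M ∩ F).card + κ < (M ∩ F + A).card := by
      refine lt_of_le_of_ne (hκ _ hne hIA) fun h => ?_
      have := hmin _ hne hIA h.symm
      omega
    have h2 : (M ∩ F + A).card ≤ ((M + A) ∩ (F + A)).card :=
      Finset.card_le_card Finset.inter_add_subset
    have h3 := Finset.card_union_add_card_inter (M + A) (F + A)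
    have h4 := Finset.card_union_add_card_inter M F
    rw [← Finset.union_add] at h3
    by_cases hV : M ∪ F + A = Finset.univ
    · -- the dual of `M` has at least `#M` elements
      have h5 : M.card ≤ (-(M + A)ᶜ).card := by
        have hd : -(M + A)ᶜ + A ⊆ -Mᶜ := by
          intro z hz
          obtain ⟨x, hx, a, ha, rfl⟩ := Finset.mem_add.1 hz
          rw [Finset.mem_neg', Finset.mem_compl] at hx ⊢
          intro h
          apply hx
          exact Finset.mem_add.2 ⟨_, h, a, ha, by abel⟩
        have hd' := Finset.card_le_card hd
        rw [Finset.card_neg, Finset.card_compl] at hd'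
        have hne' : (-(M + A)ᶜ).Nonempty := by
          rw [Finset.neg_nonempty_iff, Finset.nonempty_iff_ne_empty, Ne, Finset.compl_eq_empty_iff]
          exact hMA
        have hU : -(M + A)ᶜ + A ≠ Finset.univ := fun h => by
          have := hd (h ▸ Finset.mem_univ (0 : G))
          rw [Finset.mem_neg', neg_zero, Finset.mem_compl] at this
          exact this hM0
        have hk := hκ _ hne' hU
        apply hmin _ hne' hU
        rw [Finset.card_neg, Finset.card_compl] at hk ⊢
        have := Finset.card_le_univ M
        have := Finset.card_le_univ (M + A)
        omega
      rw [Finset.card_neg, Finset.card_compl] at h5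
      rw [hV, Finset.card_univ] at h3
      have := Finset.card_pos.2 hne
      have := Finset.card_pos.2 ⟨0, hM0⟩
      omega
    · have := hκ _ ⟨0, Finset.mem_union_left _ hM0⟩ hV
      omega
  have hadd : ∀ m ∈ M, {m} + M = M := fun m hm => htrans m
    ⟨m, Finset.mem_inter.2 ⟨hm, Finset.mem_add.2 ⟨m, by simp, 0, hM0, by simp⟩⟩⟩
  obtain ⟨a, ha, haM⟩ : ∃ a ∈ A, a ∉ M := by
    by_contra! h
    apply hMA
    have hneg : ∀ m ∈ M, -m ∈ M := by
      intro m hm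
      have : (0 : G) ∈ {m} + M := by rw [hadd m hm]; exact hM0
      obtain ⟨x, hx, y, hy, hxy⟩ := Finset.mem_add.1 this
      rw [Finset.mem_singleton] at hx
      rwa [← hx, neg_eq_of_add_eq_zero_right hxy]
    let H : AddSubgroup G :=
      { carrier := M
        zero_mem' := hM0
        add_mem' := fun {x y} hx hy => by
          have := Finset.add_mem_add (Finset.mem_singleton_self x) (Finset.mem_coe.1 hy)
          rwa [hadd x hx] at this
        neg_mem' := fun {x} hx => hneg x hx }
    have hH : AddSubgroup.closure (A : Set G) ≤ H := (AddSubgroup.closure_le H).2 h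
    rw [hA] at hH
    refine Finset.univ_subset_iff.1 fun x _ => ?_
    simpa using Finset.add_mem_add (show x ∈ M from hH (AddSubgroup.mem_top x)) h0
  have hdisj : Disjoint M ({a} + M) := by
    rw [Finset.disjoint_iff_inter_eq_empty, ← Finset.not_nonempty_iff_eq_empty]
    intro h
    apply haM
    rw [← htrans a h]
    exact Finset.mem_add.2 ⟨a, by simp, 0, hM0, by simp⟩
  have h1 : (M ∪ ({a} + M)).card ≤ (M + A).card := by
    refine Finset.card_le_card (Finset.union_subset ?_ ?_)
    · intro y hy
      simpa using Finset.add_mem_add hy h0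
    · rw [add_comm]
      exact Finset.add_subset_add_left (by simpa using ha)
  rw [Finset.card_union_of_disjoint hdisj, Finset.card_singleton_add] at h1
  have h2 : A.card ≤ (M + A).card :=
    Finset.card_le_card fun y hy => by simpa using Finset.add_mem_add hM0 hy
  have := hκ X hX hXA
  omega

/-- If `0 ∈ A` and `S + A` is not stable under translations by `A`, then
`|S + A| ≥ |S| + |A| / 2`. -/
theorem card_add_two_mul_card_le_of_not_stable {G : Type*} [AddCommGroup G] [Fintype G]
    [DecidableEq G] {A S : Finset G} (h0 : 0 ∈ A) (hS : ¬ S + A + A ⊆ S + A) :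
    A.card + 2 * S.card ≤ 2 * (S + A).card := by
  classical
  obtain ⟨y, hy, hyS⟩ := Finset.not_subset.1 hS
  obtain ⟨x, hx, a, ha, rfl⟩ := Finset.mem_add.1 hy
  obtain ⟨s, hs, b, hb, rfl⟩ := Finset.mem_add.1 hx
  set H := AddSubgroup.closure (A : Set G)
  have hAH : ∀ a ∈ A, a ∈ H := fun a ha => AddSubgroup.subset_closure ha
  let A' : Finset H := Finset.univ.filter fun h => (h : G) ∈ A
  let X : Finset H := Finset.univ.filter fun h => s + (h : G) ∈ S
  have hA'A : A'.image ((↑) : H → G) = A := by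
    ext z
    simp only [Finset.mem_image, A', Finset.mem_filter, Finset.mem_univ, true_and]
    exact ⟨fun ⟨w, hw, hz⟩ => hz ▸ hw, fun hz => ⟨⟨z, hAH z hz⟩, hz, rfl⟩⟩
  have hcard : A'.card = A.card := by
    rw [← hA'A, Finset.card_image_of_injective _ Subtype.val_injective]
  have hcl : AddSubgroup.closure (A' : Set H) = ⊤ := by
    rw [← AddSubgroup.closure_closure_coe_preimage (k := (A : Set G))]
    congr 1
    ext z
    simp [A']
  have hXA : X + A' ≠ Finset.univ := by
    intro h
    have hm : (⟨b + a, H.add_mem (hAH b hb) (hAH a ha)⟩ : H) ∈ X + A' := h ▸ Finset.mem_univ _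
    obtain ⟨p, hp, q, hq, hpq⟩ := Finset.mem_add.1 hm
    apply hyS
    simp only [X, A', Finset.mem_filter, Finset.mem_univ, true_and] at hp hq
    refine Finset.mem_add.2 ⟨_, hp, _, hq, ?_⟩
    have := congrArg Subtype.val hpq
    simp only [AddSubgroup.coe_add] at this
    rw [add_assoc, this, add_assoc]
  have key := card_add_two_mul_card_le_of_closure_eq_top (A := A') (X := X)
    (by simp [A', h0]) hcl ⟨0, by simp [X, hs]⟩ hXA
  let e : H → G := fun h => s + h
  have he : Function.Injective e := fun p q h => Subtype.ext (add_left_cancel h)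
  have hcX : (X.image e).card = X.card := Finset.card_image_of_injective _ he
  have hXS : X.image e ⊆ S := by
    intro z hz
    obtain ⟨w, hw, rfl⟩ := Finset.mem_image.1 hz
    simpa [X] using hw
  have hcXA : ((X + A').image e).card = (X + A').card := Finset.card_image_of_injective _ he
  have hdisj : Disjoint (S \ X.image e) ((X + A').image e) := by
    rw [Finset.disjoint_left]
    intro z hz hz'
    rw [Finset.mem_sdiff] at hz
    obtain ⟨w, -, rfl⟩ := Finset.mem_image.1 hz'
    exact hz.2 (Finset.mem_image.2 ⟨w, by simpa [X] using hz.1, rfl⟩)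
  have hle : (S \ X.image e ∪ (X + A').image e).card ≤ (S + A).card := by
    refine Finset.card_le_card (Finset.union_subset ?_ ?_)
    · intro z hz
      simpa using Finset.add_mem_add (Finset.mem_sdiff.1 hz).1 h0
    · intro z hz
      obtain ⟨w, hw, rfl⟩ := Finset.mem_image.1 hz
      obtain ⟨p, hp, q, hq, rfl⟩ := Finset.mem_add.1 hw
      refine Finset.mem_add.2 ⟨s + p, by simpa [X] using hp, q, by simpa [A'] using hq, ?_⟩
      simp [e, add_assoc]
  rw [Finset.card_union_of_disjoint hdisj] at hle
  have := Finset.card_sdiff_add_card_eq_card hXS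
  omega

theorem zero_mem_sum_of_zero_mem {ι G : Type*} [AddCommMonoid G] [DecidableEq G]
    {A : ι → Finset G} {P : Finset ι} (h : ∀ i ∈ P, 0 ∈ A i) : (0 : G) ∈ ∑ i ∈ P, A i := by
  classical
  induction P using Finset.induction_on with
  | empty => simp
  | insert i P hi ih =>
    rw [Finset.sum_insert hi]
    refine Finset.mem_add.2 ⟨0, h i (by simp), 0, ih fun j hj => h j (by simp [hj]), by simp⟩

theorem exists_add_of_mem_sum {ι G : Type*} [AddCommMonoid G] [DecidableEq G] [DecidableEq ι]
    {A : ι → Finset G} {Q P : Finset ι} (hQP : Q ⊆ P) {x : G} (hx : x ∈ ∑ i ∈ P, A i) :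
    ∃ o ∈ ∑ i ∈ Q, A i, ∃ r ∈ ∑ i ∈ P \ Q, A i, o + r = x := by
  rw [← Finset.sum_sdiff hQP, add_comm] at hx
  exact Finset.mem_add.1 hx

theorem add_mem_sum_of_subset {ι G : Type*} [AddCommMonoid G] [DecidableEq G] [DecidableEq ι]
    {A : ι → Finset G} {Q P : Finset ι} (hQP : Q ⊆ P) {o r : G} (ho : o ∈ ∑ i ∈ Q, A i)
    (hr : r ∈ ∑ i ∈ P \ Q, A i) : o + r ∈ ∑ i ∈ P, A i := by
  rw [← Finset.sum_sdiff hQP, add_comm o]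
  exact Finset.add_mem_add hr ho

/-- The number of summands of size at least `k` not contained in the stabilizer of the sumset. -/
theorem mul_card_not_subset_stabilizer_le {ι G : Type*} [AddCommGroup G] [Fintype G]
    [DecidableEq G] {A : ι → Finset G} {P : Finset ι} (h0 : ∀ i ∈ P, 0 ∈ A i) {k : ℕ}
    {R : Finset ι} (hRP : R ⊆ P) (hR : ∀ i ∈ R, k ≤ (A i).card ∧
      ¬ ∀ a ∈ A i, a ∈ AddAction.stabilizer G (∑ i ∈ P, A i)) :
    k * R.card ≤ 2 * Fintype.card G := by
  classical
  suffices h : k * R.card ≤ 2 * (∑ i ∈ R, A i).card from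
    h.trans (Nat.mul_le_mul_left _ (Finset.card_le_univ _))
  induction R using Finset.induction_on with
  | empty => simp
  | insert i Q hi ih =>
    obtain ⟨hk, hns⟩ := hR i (by simp)
    have hQP : Q ⊆ P := (Finset.subset_insert _ _).trans hRP
    have ih := ih hQP fun j hj => hR j (by simp [hj])
    rw [Finset.card_insert_of_notMem hi]
    have hnew : ¬ ∑ j ∈ Q, A j + A i + A i ⊆ ∑ j ∈ Q, A j + A i := by
      intro hst
      refine hns fun a ha => ?_
      rw [AddAction.mem_stabilizer_finset']
      intro x hx
      obtain ⟨o, ho, r, hr, rfl⟩ := exists_add_of_mem_sum hRP hx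
      rw [vadd_eq_add, ← add_assoc]
      refine add_mem_sum_of_subset hRP ?_ hr
      rw [Finset.sum_insert hi, add_comm] at ho ⊢
      rw [add_comm a]
      exact hst (Finset.add_mem_add ho ha)
    have := card_add_two_mul_card_le_of_not_stable (h0 i (hRP (by simp))) hnew
    rw [Finset.sum_insert hi, add_comm (A i)]
    nlinarith

/-- The number of summands not contained in the stabilizer of the sumset is less than its index. -/
theorem card_not_subset_stabilizer_lt {ι G : Type*} [AddCommGroup G] [Fintype G]
    [DecidableEq G] {A : ι → Finset G} {P : Finset ι} (h0 : ∀ i ∈ P, 0 ∈ A i)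
    {R : Finset ι} (hRP : R ⊆ P) (hR : ∀ i ∈ R,
      ¬ ∀ a ∈ A i, a ∈ AddAction.stabilizer G (∑ i ∈ P, A i)) :
    R.card < (AddAction.stabilizer G (∑ i ∈ P, A i)).index := by
  classical
  set T := AddAction.stabilizer G (∑ i ∈ P, A i) with hT
  let π : G →+ G ⧸ T := QuotientAddGroup.mk' T
  suffices h : R.card < ((∑ i ∈ R, A i).image π).card by
    refine h.trans_le ?_
    rw [AddSubgroup.index, Nat.card_eq_fintype_card]
    exact Finset.card_le_univ _
  induction R using Finset.induction_on with
  | empty => simp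
  | insert i Q hi ih =>
    have hQP : Q ⊆ P := (Finset.subset_insert _ _).trans hRP
    have ih := ih hQP fun j hj => hR j (by simp [hj])
    rw [Finset.card_insert_of_notMem hi]
    refine (Nat.succ_le_of_lt ih).trans_lt (Finset.card_lt_card ?_)
    have hsub : ∑ j ∈ Q, A j ⊆ ∑ j ∈ insert i Q, A j := by
      intro x hx
      rw [Finset.sum_insert hi]
      simpa using Finset.add_mem_add (h0 i (hRP (by simp))) hx
    refine (Finset.image_subset_image hsub).ssubset_of_ne fun heq => ?_
    refine hR i (by simp) fun a ha => ?_
    rw [hT, AddAction.mem_stabilizer_finset']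
    intro x hx
    obtain ⟨o, ho, r, hr, rfl⟩ := exists_add_of_mem_sum hQP hx
    have hao : π (a + o) ∈ (∑ j ∈ Q, A j).image π := by
      rw [heq, Finset.sum_insert hi]
      exact Finset.mem_image_of_mem _ (Finset.add_mem_add ha ho)
    obtain ⟨o', ho', he⟩ := Finset.mem_image.1 hao
    have ht : -(o' + r) + (a + (o + r)) ∈ T := by
      have := QuotientAddGroup.eq.1 (show (o' : G ⧸ T) = (a + o : G) from he)
      convert this using 1
      abel
    have := (AddAction.mem_stabilizer_finset'.1 (hT ▸ ht)) (add_mem_sum_of_subset hQP ho' hr)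
    rw [vadd_eq_add] at this ⊢
    convert this using 1
    abel

/-- A criterion for a sumset to cover all residues modulo `n`. -/
theorem exists_mem_sum_dvd_sub {ι : Type*} {B : ι → Finset ℤ} {P Pa : Finset ι} {n k : ℕ}
    (hn : 0 < n) (hPa : Pa ⊆ P) (h0 : ∀ i ∈ P, 0 ∈ B i)
    (hk : ∀ i ∈ Pa, k ≤ ((B i).image ((↑) : ℤ → ZMod n)).card) (hkP : 2 * n < k * Pa.card)
    (hτ : ∀ τ : ℕ, 2 ≤ τ → (∃ i ∈ Pa, ∀ b ∈ B i, (τ : ℤ) ∣ b) →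
      τ ≤ (P.filter fun i => ¬ ∀ b ∈ B i, (τ : ℤ) ∣ b).card) (x : ℤ) :
    ∃ s ∈ ∑ i ∈ P, B i, (n : ℤ) ∣ x - s := by
  classical
  have : NeZero n := ⟨hn.ne'⟩
  let A : ι → Finset (ZMod n) := fun i => (B i).image ((↑) : ℤ → ZMod n)
  have hA : ∑ i ∈ P, A i = (∑ i ∈ P, B i).image ((↑) : ℤ → ZMod n) := by
    have : ∀ Q : Finset ι, ∑ i ∈ Q, A i = (∑ i ∈ Q, B i).image (Int.castAddHom (ZMod n)) := by
      intro Q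
      induction Q using Finset.induction_on with
      | empty =>
        change (0 : Finset (ZMod n)) = ({0} : Finset ℤ).image (Int.castAddHom (ZMod n))
        rw [Finset.image_singleton, map_zero]
        rfl
      | insert i Q hi ih =>
        rw [Finset.sum_insert hi, Finset.sum_insert hi, Finset.image_add, ih]
        rfl
    exact this P
  have hA0 : ∀ i ∈ P, 0 ∈ A i := fun i hi => Finset.mem_image.2 ⟨0, h0 i hi, by simp⟩
  set T := AddAction.stabilizer (ZMod n) (∑ i ∈ P, A i) with hT
  -- the index of the stabilizer
  obtain ⟨τ, hτT, hτi⟩ : ∃ τ : ℕ, (∀ b : ℤ, (b : ZMod n) ∈ T ↔ (τ : ℤ) ∣ b) ∧ T.index = τ := by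
    obtain ⟨g, hg⟩ := Int.subgroup_cyclic (T.comap (Int.castAddHom (ZMod n)))
    rw [← AddSubgroup.zmultiples_eq_closure] at hg
    refine ⟨g.natAbs, fun b => ?_, ?_⟩
    · rw [Int.natAbs_dvd, ← Int.mem_zmultiples_iff, ← hg]
      rfl
    · rw [← AddSubgroup.index_comap_of_surjective T (f := Int.castAddHom (ZMod n))
        ZMod.intCast_surjective, hg, Int.index_zmultiples]
  have hAT : ∀ i, (∀ a ∈ A i, a ∈ T) ↔ ∀ b ∈ B i, (τ : ℤ) ∣ b := by
    intro i
    simp [A, hτT]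
  have hbad := card_not_subset_stabilizer_lt hA0 (Finset.filter_subset
    (fun i => ¬ ∀ b ∈ B i, (τ : ℤ) ∣ b) P) (by
      intro i hi
      rw [← hT, hAT]
      exact (Finset.mem_filter.1 hi).2)
  rw [← hT, hτi] at hbad
  have hbig := mul_card_not_subset_stabilizer_le hA0 (k := k) ((Finset.filter_subset
    (fun i => ¬ ∀ b ∈ B i, (τ : ℤ) ∣ b) Pa).trans hPa) (by
      intro i hi
      rw [← hT, hAT]
      exact ⟨hk i (Finset.mem_filter.1 hi).1, (Finset.mem_filter.1 hi).2⟩)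
  rw [ZMod.card] at hbig
  have hex : ∃ i ∈ Pa, ∀ b ∈ B i, (τ : ℤ) ∣ b := by
    by_contra! h
    rw [Finset.filter_true_of_mem (by
      intro i hi
      simpa using h i hi)] at hbig
    omega
  have hτ1 : τ = 1 := by
    by_contra h1
    have hτ0 : τ ≠ 0 := by omega
    have := hτ τ (by omega) hex
    omega
  have hx : (x : ZMod n) ∈ ∑ i ∈ P, A i := by
    have hxT : (x : ZMod n) ∈ T := (hτT x).2 (by simp [hτ1])
    have := AddAction.mem_stabilizer_finset'.1 (hT ▸ hxT) (zero_mem_sum_of_zero_mem hA0)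
    simpa using this
  rw [hA] at hx
  obtain ⟨s, hs, hsx⟩ := Finset.mem_image.1 hx
  exact ⟨s, hs, (ZMod.intCast_eq_intCast_iff_dvd_sub _ _ _).1 hsx⟩

theorem exists_subset_card_eq_forall_le {ι : Type*} [DecidableEq ι] (l : ι → ℕ) (X : Finset ι)
    {m : ℕ} (hm : m ≤ X.card) :
    ∃ Y ⊆ X, Y.card = m ∧ ∀ y ∈ Y, ∀ x ∈ X \ Y, l y ≤ l x := by
  induction m with
  | zero => exact ⟨∅, by simp, by simp, by simp⟩
  | succ m ih =>
    obtain ⟨Y, hYX, hY, hle⟩ := ih (by omega)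
    have hne : (X \ Y).Nonempty := by
      rw [← Finset.card_pos, Finset.card_sdiff_of_subset hYX]
      omega
    obtain ⟨z, hz, hzmin⟩ := Finset.exists_min_image (X \ Y) l hne
    rw [Finset.mem_sdiff] at hz
    refine ⟨insert z Y, Finset.insert_subset hz.1 hYX, ?_, ?_⟩
    · rw [Finset.card_insert_of_notMem hz.2, hY]
    · intro y hy x hx
      have hx' : x ∈ X \ Y := by
        simp only [Finset.mem_sdiff, Finset.mem_insert, not_or] at hx ⊢
        exact ⟨hx.1, hx.2.2⟩
      rcases Finset.mem_insert.1 hy with rfl | hy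
      · exact hzmin x hx'
      · exact hle y hy x hx'

theorem card_mul_sum_le_of_forall_le {ι : Type*} [DecidableEq ι] {l : ι → ℕ} {X Y : Finset ι}
    (hYX : Y ⊆ X) (hle : ∀ y ∈ Y, ∀ x ∈ X \ Y, l y ≤ l x) :
    X.card * ∑ i ∈ Y, l i ≤ Y.card * ∑ i ∈ X, l i := by
  have h1 : (X \ Y).card * ∑ i ∈ Y, l i ≤ Y.card * ∑ i ∈ X \ Y, l i := by
    calc (X \ Y).card * ∑ i ∈ Y, l i = ∑ _x ∈ X \ Y, ∑ y ∈ Y, l y := by simp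
      _ ≤ ∑ x ∈ X \ Y, ∑ _y ∈ Y, l x :=
        Finset.sum_le_sum fun x hx => Finset.sum_le_sum fun y hy => hle y hy x hx
      _ = Y.card * ∑ i ∈ X \ Y, l i := by simp [Finset.mul_sum]
  rw [← Finset.sum_sdiff hYX, ← Finset.card_sdiff_add_card_eq_card hYX]
  nlinarith

/-- A sub-family of prescribed size and small total weight. -/
theorem exists_light_subset {ι : Type*} [DecidableEq ι] (l : ι → ℕ) {X F : Finset ι} (hXF : X ⊆ F)
    {m θ : ℕ} (hm : m ≤ X.card) (hθ : θ ≤ X.card) :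
    ∃ Y ⊆ X, Y.card = m ∧ (∀ y ∈ Y, ∀ x ∈ X \ Y, l y ≤ l x) ∧
      θ * ∑ i ∈ Y, l i ≤ m * ∑ i ∈ F, l i := by
  obtain ⟨Y, hYX, hY, hle⟩ := exists_subset_card_eq_forall_le l X hm
  refine ⟨Y, hYX, hY, hle, ?_⟩
  calc θ * ∑ i ∈ Y, l i ≤ X.card * ∑ i ∈ Y, l i := Nat.mul_le_mul_right _ hθ
    _ ≤ Y.card * ∑ i ∈ X, l i := card_mul_sum_le_of_forall_le hYX hle
    _ ≤ m * ∑ i ∈ F, l i := by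
      rw [hY]
      exact Nat.mul_le_mul_left _ (Finset.sum_le_sum_of_subset hXF)

theorem exists_subset_sum_between {ι : Type*} [DecidableEq ι] {l : ι → ℕ} {R : Finset ι}
    {m U : ℕ} (hU : ∀ i ∈ R, l i ≤ U) (hm : m ≤ ∑ i ∈ R, l i) :
    ∃ Q ⊆ R, m ≤ ∑ i ∈ Q, l i ∧ ∑ i ∈ Q, l i ≤ m + U := by
  induction R using Finset.induction_on with
  | empty => exact ⟨∅, le_rfl, hm, by simp⟩
  | insert i R hi ih =>
    by_cases h : m ≤ ∑ i ∈ R, l i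
    · obtain ⟨Q, hQ, h1, h2⟩ := ih (fun j hj => hU j (by simp [hj])) h
      exact ⟨Q, hQ.trans (Finset.subset_insert _ _), h1, h2⟩
    · refine ⟨insert i R, le_rfl, hm, ?_⟩
      rw [Finset.sum_insert hi]
      have := hU i (by simp)
      omega

/-- If many sets avoid each `pℤ`, then a light sub-family has, for each divisor `τ ≥ 2` of `h`, at
least `τ` sets avoiding `τℤ`. -/
theorem exists_light_subset_forall_dvd {ι : Type*} [DecidableEq ι] (l : ι → ℕ)
    (B : ι → Finset ℤ) {F : Finset ι} {θ : ℕ}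
    (hθ : ∀ p : ℕ, p.Prime → θ ≤ (F.filter fun i => ¬ ∀ b ∈ B i, (p : ℤ) ∣ b).card) (h : ℕ)
    (h1 : 1 ≤ h) (hhθ : h ≤ θ) :
    ∃ P ⊆ F, P.card ≤ 2 * h ∧ θ * ∑ i ∈ P, l i ≤ 2 * h * ∑ i ∈ F, l i ∧
      ∀ τ : ℕ, 2 ≤ τ → τ ∣ h → τ ≤ (P.filter fun i => ¬ ∀ b ∈ B i, (τ : ℤ) ∣ b).card := by
  induction h using Nat.strong_induction_on with
  | _ h ih =>
  by_cases hh : h = 1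
  · refine ⟨∅, by simp, by simp, by simp, fun τ hτ hd => ?_⟩
    rw [hh, Nat.dvd_one] at hd
    omega
  set p := h.minFac with hp
  have hpp : p.Prime := Nat.minFac_prime hh
  obtain ⟨h', hh'⟩ : p ∣ h := Nat.minFac_dvd h
  have h2 := hpp.two_le
  have hh'0 : 1 ≤ h' := by
    by_contra h0
    have : h' = 0 := by omega
    simp [this] at hh'
    omega
  have hle : 2 * h' ≤ h := by rw [hh']; exact Nat.mul_le_mul_right _ h2
  obtain ⟨P, hPF, hPc, hPl, hPτ⟩ := ih h' (by omega) hh'0 (by omega)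
  obtain ⟨Y, hYX, hYc, -, hYl⟩ := exists_light_subset l
    (Finset.filter_subset (fun i => ¬ ∀ b ∈ B i, (p : ℤ) ∣ b) F) (hhθ.trans (hθ p hpp)) (hθ p hpp)
  refine ⟨P ∪ Y, Finset.union_subset hPF (hYX.trans (Finset.filter_subset _ _)), ?_, ?_, ?_⟩
  · have := Finset.card_union_le P Y
    omega
  · have hs : ∑ i ∈ P ∪ Y, l i ≤ ∑ i ∈ P, l i + ∑ i ∈ Y, l i := by
      rw [← Finset.sum_union_inter]
      omega
    calc θ * ∑ i ∈ P ∪ Y, l i ≤ θ * (∑ i ∈ P, l i + ∑ i ∈ Y, l i) := Nat.mul_le_mul_left _ hs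
      _ ≤ (2 * h' + h) * ∑ i ∈ F, l i := by rw [mul_add, add_mul]; exact add_le_add hPl hYl
      _ ≤ 2 * h * ∑ i ∈ F, l i := Nat.mul_le_mul_right _ (by omega)
  · intro τ hτ hτh
    by_cases hpτ : p ∣ τ
    · calc τ ≤ h := Nat.le_of_dvd (by omega) hτh
        _ = Y.card := hYc.symm
        _ ≤ _ := by
          refine Finset.card_le_card fun i hi => ?_
          rw [Finset.mem_filter]
          refine ⟨Finset.mem_union_right _ hi, fun hall => ?_⟩
          refine (Finset.mem_filter.1 (hYX hi)).2 fun b hb => ?_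
          exact (Int.natCast_dvd_natCast.2 hpτ).trans (hall b hb)
    · have hcop : Nat.Coprime τ p := ((Nat.Prime.coprime_iff_not_dvd hpp).2 hpτ).symm
      rw [hh'] at hτh
      refine (hPτ τ hτ (hcop.dvd_of_dvd_mul_left hτh)).trans (Finset.card_le_card ?_)
      exact Finset.filter_subset_filter _ Finset.subset_union_left

theorem mul_le_of_forall_dvd {B : Finset ℤ} {τ k U : ℕ} (hB : ∀ b ∈ B, 0 ≤ b ∧ b ≤ U)
    (hk : k + 1 ≤ B.card) (hτ : 1 ≤ τ) (hd : ∀ b ∈ B, (τ : ℤ) ∣ b) : τ * k ≤ U := by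
  have hsub : B ⊆ (Finset.range (U / τ + 1)).image fun j : ℕ => (τ : ℤ) * j := by
    intro b hb
    obtain ⟨c, rfl⟩ := hd b hb
    obtain ⟨hb0, hbU⟩ := hB _ hb
    have hτ' : (0 : ℤ) < τ := by exact_mod_cast hτ
    lift c to ℕ using nonneg_of_mul_nonneg_right hb0 hτ'
    refine Finset.mem_image.2 ⟨c, Finset.mem_range_succ_iff.2 ?_, rfl⟩
    rw [Nat.le_div_iff_mul_le hτ, mul_comm]
    exact_mod_cast hbU
  have := (Finset.card_le_card hsub).trans Finset.card_image_le
  rw [Finset.card_range] at this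
  rw [mul_comm, ← Nat.le_div_iff_mul_le hτ]
  omega

theorem le_card_image_zmod {B : Finset ℤ} {k n : ℕ} (hB : ∀ b ∈ B, 0 ≤ b ∧ b ≤ n)
    (hk : k + 1 ≤ B.card) : k ≤ (B.image ((↑) : ℤ → ZMod n)).card := by
  have hinj : Set.InjOn ((↑) : ℤ → ZMod n) (B.erase n : Set ℤ) := by
    intro x hx y hy hxy
    rw [Finset.mem_coe, Finset.mem_erase] at hx hy
    have hx' := hB x hx.2
    have hy' := hB y hy.2
    rw [ZMod.intCast_eq_intCast_iff' x y n, Int.emod_eq_of_lt hx'.1 (lt_of_le_of_ne hx'.2 hx.1),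
      Int.emod_eq_of_lt hy'.1 (lt_of_le_of_ne hy'.2 hy.1)] at hxy
    exact hxy
  calc k ≤ (B.erase n).card := by
        have := Finset.pred_card_le_card_erase (s := B) (a := (n : ℤ))
        omega
    _ = ((B.erase n).image ((↑) : ℤ → ZMod n)).card := (Finset.card_image_of_injOn hinj).symm
    _ ≤ _ := Finset.card_le_card (Finset.image_subset_image (Finset.erase_subset _ _))

/-- The sets `B i`, `i ∈ F`, have minimum `0`, maximum `l i ≤ U`, and more than `k` elements. -/
structure IsNormalized {ι : Type*} (F : Finset ι) (B : ι → Finset ℤ) (l : ι → ℕ) (k U : ℕ) :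
    Prop where
  zero_mem : ∀ i ∈ F, 0 ∈ B i
  mem_Icc : ∀ i ∈ F, ∀ b ∈ B i, 0 ≤ b ∧ b ≤ l i
  last_mem : ∀ i ∈ F, (l i : ℤ) ∈ B i
  le : ∀ i ∈ F, l i ≤ U
  lt_card : ∀ i ∈ F, k + 1 ≤ (B i).card

theorem IsNormalized.mono {ι : Type*} {F F' : Finset ι} {B : ι → Finset ℤ} {l : ι → ℕ} {k U : ℕ}
    (h : IsNormalized F B l k U) (hF : F' ⊆ F) : IsNormalized F' B l k U :=
  ⟨fun i hi => h.zero_mem i (hF hi), fun i hi => h.mem_Icc i (hF hi),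
    fun i hi => h.last_mem i (hF hi), fun i hi => h.le i (hF hi), fun i hi => h.lt_card i (hF hi)⟩

theorem IsNormalized.mem_Icc' {ι : Type*} {F : Finset ι} {B : ι → Finset ℤ} {l : ι → ℕ} {k U : ℕ}
    (h : IsNormalized F B l k U) {i : ι} (hi : i ∈ F) : ∀ b ∈ B i, 0 ≤ b ∧ b ≤ U := fun b hb =>
  ⟨(h.mem_Icc i hi b hb).1, (h.mem_Icc i hi b hb).2.trans (by exact_mod_cast h.le i hi)⟩

theorem IsNormalized.le_length {ι : Type*} {F : Finset ι} {B : ι → Finset ℤ} {l : ι → ℕ} {k U : ℕ}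
    (h : IsNormalized F B l k U) {i : ι} (hi : i ∈ F) : k ≤ l i := by
  simpa using mul_le_of_forall_dvd (τ := 1) (h.mem_Icc i hi) (h.lt_card i hi) le_rfl (by simp)

/-- A light sub-family whose sumset covers all residues modulo the length of any other set. -/
theorem IsNormalized.exists_light_covering {ι : Type*} [DecidableEq ι] {F : Finset ι}
    {B : ι → Finset ℤ} {l : ι → ℕ} {k U : ℕ} (hF : IsNormalized F B l k U) (hk : 1 ≤ k) {N θ : ℕ}
    (hN : 1 ≤ N) (hNU : N = U / k) (hNθ : 6 * N ≤ θ)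
    (hθ : ∀ p : ℕ, p.Prime → θ ≤ (F.filter fun i => ¬ ∀ b ∈ B i, (p : ℤ) ∣ b).card) :
    ∃ P ⊆ F, P.card ≤ 6 * N ∧ θ * ∑ i ∈ P, l i ≤ 6 * N * ∑ i ∈ F, l i ∧
      ∀ i ∈ F \ P, ∀ x : ℤ, ∃ s ∈ ∑ i ∈ P, B i, (l i : ℤ) ∣ x - s := by
  have hNle : ∀ τ : ℕ, 1 ≤ τ → ∀ i ∈ F, (∀ b ∈ B i, (τ : ℤ) ∣ b) → τ ≤ N := by
    intro τ hτ i hi hd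
    rw [hNU, Nat.le_div_iff_mul_le hk]
    exact mul_le_of_forall_dvd (hF.mem_Icc' hi) (hF.lt_card i hi) hτ hd
  have hθF : θ ≤ F.card := (hθ 2 Nat.prime_two).trans (Finset.card_le_card
    (Finset.filter_subset _ _))
  obtain ⟨Pa, hPaF, hPac, hPale, hPal⟩ := exists_light_subset l (le_refl F) (m := 4 * N) (θ := θ)
    (by omega) hθF
  let bad : ℕ → Finset ι := fun τ => Pa.filter fun i => ¬ ∀ b ∈ B i, (τ : ℤ) ∣ b
  let S : Finset ℕ := (Finset.Icc 1 N).filter fun τ => (bad τ).card < τ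
  obtain ⟨h, hhS, hmax⟩ := S.exists_max_image id ⟨1, by simp [S, bad, hN]⟩
  simp only [S, Finset.mem_filter, Finset.mem_Icc, id] at hhS hmax
  obtain ⟨⟨hh1, hhN⟩, hhb⟩ := hhS
  have hdvd : ∀ τ, 1 ≤ τ → τ ≤ N → (bad τ).card < τ → τ ∣ h := by
    intro τ hτ1 hτN hτb
    by_contra hnd
    have hτh := hmax τ ⟨⟨hτ1, hτN⟩, hτb⟩
    have hlcm : 2 * h ≤ τ.lcm h := by
      obtain ⟨c, hc⟩ := Nat.dvd_lcm_right τ h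
      rcases Nat.lt_or_ge c 2 with hc2 | hc2
      · interval_cases c
        · have := Nat.lcm_pos (m := τ) (n := h) (by omega) (by omega)
          omega
        · exact absurd (by simpa [hc] using Nat.dvd_lcm_left τ h) hnd
      · rw [hc, mul_comm]
        exact Nat.mul_le_mul_left _ hc2
    have hsub : bad (τ.lcm h) ⊆ bad τ ∪ bad h := by
      intro i hi
      simp only [bad, Finset.mem_union, Finset.mem_filter] at hi ⊢
      by_contra hcon
      refine hi.2 fun b hb => ?_
      have h1 : (τ : ℤ) ∣ b := by
        by_contra hb'
        exact hcon (Or.inl ⟨hi.1, fun hall => hb' (hall b hb)⟩)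
      have h2 : (h : ℤ) ∣ b := by
        by_contra hb'
        exact hcon (Or.inr ⟨hi.1, fun hall => hb' (hall b hb)⟩)
      rw [Int.natCast_dvd] at h1 h2 ⊢
      exact Nat.lcm_dvd h1 h2
    have hcard := (Finset.card_le_card hsub).trans (Finset.card_union_le _ _)
    obtain ⟨i, hi, hid⟩ : ∃ i ∈ Pa, ∀ b ∈ B i, ((τ.lcm h : ℕ) : ℤ) ∣ b := by
      by_contra! hno
      have : bad (τ.lcm h) = Pa := Finset.filter_true_of_mem fun i hi => by
        simpa using hno i hi
      rw [this] at hcard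
      omega
    have := hmax (τ.lcm h) ⟨⟨by omega, hNle _ (by omega) i (hPaF hi) hid⟩, by omega⟩
    omega
  obtain ⟨Pb, hPbF, hPbc, hPbl, hPbτ⟩ := exists_light_subset_forall_dvd l B hθ h hh1 (by omega)
  refine ⟨Pa ∪ Pb, Finset.union_subset hPaF hPbF, ?_, ?_, ?_⟩
  · have := Finset.card_union_le Pa Pb
    omega
  · have hs : ∑ i ∈ Pa ∪ Pb, l i ≤ ∑ i ∈ Pa, l i + ∑ i ∈ Pb, l i := by
      rw [← Finset.sum_union_inter]
      omega
    calc θ * ∑ i ∈ Pa ∪ Pb, l i ≤ θ * (∑ i ∈ Pa, l i + ∑ i ∈ Pb, l i) := Nat.mul_le_mul_left _ hs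
      _ ≤ (4 * N + 2 * h) * ∑ i ∈ F, l i := by rw [mul_add, add_mul]; exact add_le_add hPal hPbl
      _ ≤ 6 * N * ∑ i ∈ F, l i := Nat.mul_le_mul_right _ (by omega)
  · intro i hi x
    rw [Finset.mem_sdiff, Finset.mem_union, not_or] at hi
    obtain ⟨hiF, hia, -⟩ := hi
    have hki := hF.le_length hiF
    refine exists_mem_sum_dvd_sub (k := k) (Pa := Pa) (by omega) Finset.subset_union_left
      (fun j hj => hF.zero_mem j (Finset.union_subset hPaF hPbF hj)) ?_ ?_ ?_ x
    · intro j hj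
      have hji := hPale j hj i (Finset.mem_sdiff.2 ⟨hiF, hia⟩)
      refine le_card_image_zmod (fun b hb => ?_) (hF.lt_card j (hPaF hj))
      have := hF.mem_Icc j (hPaF hj) b hb
      omega
    · rw [hPac]
      have h1 := hF.le i hiF
      have h2 : U < k * (N + 1) := by
        rw [hNU]
        exact Nat.lt_mul_div_succ U hk
      nlinarith
    · rintro τ hτ ⟨j, hj, hjd⟩
      have hτN := hNle τ (by omega) j (hPaF hj) hjd
      by_cases hτb : (bad τ).card < τ
      · exact (hPbτ τ hτ (hdvd τ (by omega) hτN hτb)).trans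
          (Finset.card_le_card (Finset.filter_subset_filter _ Finset.subset_union_right))
      · exact (not_lt.1 hτb).trans
          (Finset.card_le_card (Finset.filter_subset_filter _ Finset.subset_union_left))

theorem card_add_le_of_forall_exists_dvd_sub {S A : Finset ℤ} {n : ℕ} (hn : 0 < n)
    (hS : ∀ x : ℤ, ∃ s ∈ S, (n : ℤ) ∣ x - s) (h0 : 0 ∈ A) (hnA : (n : ℤ) ∈ A) :
    S.card + n ≤ (S + A).card := by
  have : NeZero n := ⟨hn.ne'⟩
  have hsub : S ⊆ S + A := fun s hs => by simpa using Finset.add_mem_add hs h0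
  have hun : (((S + A) \ S).image ((↑) : ℤ → ZMod n)) = Finset.univ := by
    refine Finset.univ_subset_iff.1 fun r _ => ?_
    obtain ⟨x, rfl⟩ := ZMod.intCast_surjective r
    obtain ⟨s, hs, hsx⟩ := hS x
    obtain ⟨m, hm, hmax⟩ := (S.filter fun s => (n : ℤ) ∣ x - s).exists_max_image id
      ⟨s, Finset.mem_filter.2 ⟨hs, hsx⟩⟩
    rw [Finset.mem_filter] at hm
    have hd : (n : ℤ) ∣ x - (m + n) := by
      rw [← sub_sub]
      exact dvd_sub hm.2 dvd_rfl
    refine Finset.mem_image.2 ⟨m + n, Finset.mem_sdiff.2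
      ⟨Finset.add_mem_add hm.1 hnA, fun hmem => ?_⟩,
      (ZMod.intCast_eq_intCast_iff_dvd_sub _ _ _).2 hd⟩
    have := hmax (m + n) (Finset.mem_filter.2 ⟨hmem, hd⟩)
    simp only [id] at this
    omega
  have hle := Finset.card_image_le (s := (S + A) \ S) (f := ((↑) : ℤ → ZMod n))
  rw [hun, Finset.card_univ, ZMod.card] at hle
  have := Finset.card_sdiff_add_card_eq_card hsub
  omega

theorem IsNormalized.card_sum_add_sum_le {ι : Type*} [DecidableEq ι] {P Q : Finset ι}
    {B : ι → Finset ℤ} {l : ι → ℕ} {k U : ℕ} (hQ : IsNormalized Q B l k U) (hk : 1 ≤ k)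
    (hP : ∀ i ∈ Q, ∀ x : ℤ, ∃ s ∈ ∑ i ∈ P, B i, (l i : ℤ) ∣ x - s) :
    (∑ i ∈ P, B i).card + ∑ i ∈ Q, l i ≤ (∑ i ∈ P, B i + ∑ i ∈ Q, B i).card := by
  induction Q using Finset.induction_on with
  | empty => simp
  | insert i Q hi ih =>
    have hiQ : i ∈ insert i Q := Finset.mem_insert_self _ _
    have hQ' := hQ.mono (Finset.subset_insert i Q)
    have ih := ih hQ' fun j hj => hP j (by simp [hj])
    have := hQ.le_length hiQ
    have := card_add_le_of_forall_exists_dvd_sub (S := ∑ i ∈ P, B i + ∑ i ∈ Q, B i) (A := B i)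
      (n := l i) (by omega) (fun x => by
        obtain ⟨s, hs, hsx⟩ := hP i hiQ x
        exact ⟨s, by simpa using Finset.add_mem_add hs (zero_mem_sum_of_zero_mem hQ'.zero_mem),
          hsx⟩) (hQ.zero_mem i hiQ) (hQ.last_mem i hiQ)
    rw [Finset.sum_insert hi, Finset.sum_insert hi, add_comm (B i), ← add_assoc (∑ i ∈ P, B i)]
    omega

theorem IsNormalized.sum_subset_Icc {ι : Type*} [DecidableEq ι] {F : Finset ι}
    {B : ι → Finset ℤ} {l : ι → ℕ} {k U : ℕ} (h : IsNormalized F B l k U) :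
    ∑ i ∈ F, B i ⊆ Finset.Icc 0 ((∑ i ∈ F, l i : ℕ) : ℤ) := by
  induction F using Finset.induction_on with
  | empty => exact fun x hx => by simpa using hx
  | insert i F hi ih =>
    intro x hx
    rw [Finset.sum_insert hi] at hx ⊢
    obtain ⟨b, hb, s, hs, rfl⟩ := Finset.mem_add.1 hx
    have h1 := h.mem_Icc i (by simp) b hb
    have h2 := Finset.mem_Icc.1 (ih (h.mono (Finset.subset_insert i F)) hs)
    rw [Finset.mem_Icc]
    push_cast at h2 ⊢
    constructor <;> linarith

/-- If `S ⊆ [0, L]` misses fewer than `|T|` integers, `S + T` contains `[M, L]` for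
`T ⊆ [0, M]`. -/
theorem mem_add_of_card_lt {S T : Finset ℤ} {L M : ℕ} (hS : S ⊆ Finset.Icc 0 (L : ℤ))
    (hT : T ⊆ Finset.Icc 0 (M : ℤ)) (hc : L + 1 < S.card + T.card) {x : ℤ} (hMx : M ≤ x)
    (hxL : x ≤ L) : x ∈ S + T := by
  classical
  have hT' : T.image (fun t => x - t) ⊆ Finset.Icc 0 (L : ℤ) := by
    intro y hy
    obtain ⟨t, ht, rfl⟩ := Finset.mem_image.1 hy
    have := Finset.mem_Icc.1 (hT ht)
    rw [Finset.mem_Icc]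
    constructor <;> linarith
  have hcT : (T.image (fun t => x - t)).card = T.card :=
    Finset.card_image_of_injective _ fun a b hab => by simpa using hab
  have hne : (S ∩ T.image (fun t => x - t)).Nonempty := by
    rw [← Finset.card_pos]
    have h1 := Finset.card_union_add_card_inter S (T.image (fun t => x - t))
    have h2 := Finset.card_le_card (Finset.union_subset hS hT')
    rw [Int.card_Icc] at h2
    omega
  obtain ⟨y, hy⟩ := hne
  rw [Finset.mem_inter, Finset.mem_image] at hy
  obtain ⟨hyS, t, ht, rfl⟩ := hy
  exact Finset.mem_add.2 ⟨_, hyS, t, ht, by ring⟩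

/-- The sumset of a normalized family not concentrated on any `pℤ` contains a long interval. -/
theorem IsNormalized.exists_interval_subset_sum {ι : Type*} [DecidableEq ι] {F : Finset ι}
    {B : ι → Finset ℤ} {l : ι → ℕ} {k U : ℕ} (hF : IsNormalized F B l k U) (hk : 1 ≤ k)
    {N θ W : ℕ} (hN : 1 ≤ N) (hNU : N = U / k) (hNθ : 66 * N ≤ θ)
    (hθ : ∀ p : ℕ, p.Prime → θ ≤ (F.filter fun i => ¬ ∀ b ∈ B i, (p : ℤ) ∣ b).card)
    (hUW : U ≤ W) (hW : 6 * W ≤ ∑ i ∈ F, l i) :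
    ∃ I ⊆ F, ∃ a : ℤ, ∀ j < W, a + (j : ℤ) ∈ ∑ i ∈ I, B i := by
  obtain ⟨P, hPF, hPc, hPl, hP⟩ := hF.exists_light_covering hk hN hNU (by omega) hθ
  have hF' := hF.mono (Finset.sdiff_subset (s := F) (t := P))
  obtain ⟨P', hPF', hPc', hPl', hP'⟩ := hF'.exists_light_covering hk hN hNU (θ := 60 * N)
    (by omega) (fun p hp => by
      have h1 := hθ p hp
      have h2 : (F.filter fun i => ¬ ∀ b ∈ B i, (p : ℤ) ∣ b) ⊆
          ((F \ P).filter fun i => ¬ ∀ b ∈ B i, (p : ℤ) ∣ b) ∪ P := by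
        intro i hi
        rw [Finset.mem_filter] at hi
        by_cases hiP : i ∈ P
        · exact Finset.mem_union_right _ hiP
        · exact Finset.mem_union_left _
            (Finset.mem_filter.2 ⟨Finset.mem_sdiff.2 ⟨hi.1, hiP⟩, hi.2⟩)
      have h3 := (Finset.card_le_card h2).trans (Finset.card_union_le _ _)
      omega)
  have hD1 := Finset.sum_sdiff (f := l) hPF
  have hD2 := Finset.sum_sdiff (f := l) hPF'
  have hFR := hF'.mono (Finset.sdiff_subset (s := F \ P) (t := P'))
  have hPR : Disjoint P ((F \ P) \ P') :=
    Finset.disjoint_sdiff.mono_right Finset.sdiff_subset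
  have hP'R : Disjoint P' ((F \ P) \ P') := Finset.disjoint_sdiff
  have hRF : (F \ P) \ P' ⊆ F := Finset.sdiff_subset.trans Finset.sdiff_subset
  have hPR' : ∀ i ∈ (F \ P) \ P', i ∈ F \ P := fun i hi => Finset.sdiff_subset hi
  generalize (F \ P) \ P' = R at *
  have h11 : 11 * ∑ i ∈ P, l i ≤ ∑ i ∈ F, l i := by
    refine Nat.le_of_mul_le_mul_left (c := 6 * N) ?_ (by omega)
    refine le_trans ?_ hPl
    rw [← mul_assoc]
    exact Nat.mul_le_mul_right _ (by omega)
  have h10 : 10 * ∑ i ∈ P', l i ≤ ∑ i ∈ F \ P, l i := by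
    refine Nat.le_of_mul_le_mul_left (c := 6 * N) ?_ (by omega)
    refine le_trans ?_ hPl'
    rw [← mul_assoc]
    exact Nat.mul_le_mul_right _ (by omega)
  obtain ⟨Q', hQR, hQ1, hQ2⟩ := exists_subset_sum_between (m := ∑ i ∈ P, l i) hFR.le (by omega)
  have hD3 := Finset.sum_sdiff (f := l) hQR
  have hQF : R \ Q' ⊆ R := Finset.sdiff_subset
  have hQQ' : Disjoint (R \ Q') Q' := Finset.sdiff_disjoint
  generalize R \ Q' = Q at *
  have hPQ : Disjoint P Q := hPR.mono_right hQF
  have hPQ' : Disjoint P' Q' := hP'R.mono_right hQR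
  have hP'F : P' ⊆ F := hPF'.trans Finset.sdiff_subset
  have hS := ((hFR.mono hQF).card_sum_add_sum_le (P := P) hk
    fun i hi => hP i (hPR' i (hQF hi)))
  have hT := ((hFR.mono hQR).card_sum_add_sum_le (P := P') hk fun i hi => hP' i (hQR hi))
  rw [← Finset.sum_union hPQ] at hS
  rw [← Finset.sum_union hPQ'] at hT
  have hFS := (hF.mono (Finset.union_subset hPF (hQF.trans hRF))).sum_subset_Icc
  have hFT := (hF.mono (Finset.union_subset hP'F (hQR.trans hRF))).sum_subset_Icc
  rw [Finset.sum_union (f := l) hPQ] at hFS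
  rw [Finset.sum_union (f := l) hPQ'] at hFT
  have hdisj : Disjoint (P ∪ Q) (P' ∪ Q') := by
    rw [Finset.disjoint_union_left, Finset.disjoint_union_right, Finset.disjoint_union_right]
    exact ⟨⟨Finset.disjoint_sdiff.mono_right hPF', hPR.mono_right hQR⟩,
      (hP'R.mono_right hQF).symm, hQQ'⟩
  have hp1 : 0 < (∑ i ∈ P, B i).card :=
    Finset.card_pos.2 ⟨0, zero_mem_sum_of_zero_mem (hF.mono hPF).zero_mem⟩
  have hp2 : 0 < (∑ i ∈ P', B i).card :=
    Finset.card_pos.2 ⟨0, zero_mem_sum_of_zero_mem (hF.mono hP'F).zero_mem⟩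
  refine ⟨(P ∪ Q) ∪ (P' ∪ Q'), Finset.union_subset (Finset.union_subset hPF (hQF.trans hRF))
    (Finset.union_subset hP'F (hQR.trans hRF)), ((∑ i ∈ P', l i + ∑ i ∈ Q', l i : ℕ) : ℤ), ?_⟩
  intro j hj
  rw [Finset.sum_union hdisj]
  refine mem_add_of_card_lt hFS hFT (by omega) ?_ ?_
  · push_cast
    omega
  · norm_cast
    omega

theorem exists_add_mul_mem_sum_of_image {ι : Type*} [DecidableEq ι] {I : Finset ι}
    {B B' : ι → Finset ℤ} {g : ℤ} {c : ι → ℤ} (h : ∀ i ∈ I, ∀ b ∈ B' i, c i + b * g ∈ B i) {x : ℤ}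
    (hx : x ∈ ∑ i ∈ I, B' i) : ∑ i ∈ I, c i + x * g ∈ ∑ i ∈ I, B i := by
  induction I using Finset.induction_on generalizing x with
  | empty =>
    have hx0 : x = 0 := by simpa using hx
    simp [hx0]
  | insert i I hi ih =>
    rw [Finset.sum_insert hi] at hx
    rw [Finset.sum_insert hi, Finset.sum_insert hi]
    obtain ⟨b, hb, s, hs, rfl⟩ := Finset.mem_add.1 hx
    refine Finset.mem_add.2 ⟨_, h i (by simp) b hb, _, ih (fun j hj => h j (by simp [hj])) hs, ?_⟩
    ring

/-- Many sets with more than `k` elements in `[0, u]` have a sumset with a long progression. -/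
theorem IsNormalized.exists_progression {ι : Type*} [DecidableEq ι] {F : Finset ι}
    {B : ι → Finset ℤ} {l : ι → ℕ} {k u : ℕ} (hF : IsNormalized F B l k u) (hk : 1 ≤ k)
    (hku : k ≤ u) (hc : 144 * (u / k) ≤ F.card) :
    ∃ I ⊆ F, ∃ (a : ℤ) (g : ℕ), 1 ≤ g ∧ ∀ j < u, a + (j : ℤ) * g ∈ ∑ i ∈ I, B i := by
  set M := u / k with hM
  have hM1 : 1 ≤ M := by rwa [hM, Nat.one_le_div_iff hk]
  set K := 132 * M with hK
  let bad : ℕ → Finset ι := fun τ => F.filter fun i => ¬ ∀ b ∈ B i, (τ : ℤ) ∣ b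
  have hgood : ∀ τ : ℕ, (F \ bad τ).Nonempty → 1 ≤ τ → τ * k ≤ u := by
    rintro τ ⟨i, hi⟩ hτ
    rw [Finset.mem_sdiff, Finset.mem_filter] at hi
    have hd : ∀ b ∈ B i, (τ : ℤ) ∣ b := by
      by_contra h
      exact hi.2 ⟨hi.1, h⟩
    exact mul_le_of_forall_dvd (hF.mem_Icc' hi.1) (hF.lt_card i hi.1) hτ hd
  have hgood' : ∀ τ : ℕ, 1 ≤ τ → τ * (bad τ).card ≤ K * (τ - 1) →
      (bad τ).card ≤ K ∧ τ * k ≤ u := by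
    intro τ hτ hb
    have hle : (bad τ).card ≤ K := by
      refine Nat.le_of_mul_le_mul_left (c := τ) ?_ (by omega)
      refine hb.trans ?_
      rw [mul_comm]
      exact Nat.mul_le_mul_right _ (by omega)
    refine ⟨hle, hgood τ ?_ hτ⟩
    rw [← Finset.card_pos, Finset.card_sdiff_of_subset (Finset.filter_subset _ _)]
    change 0 < F.card - (bad τ).card
    omega
  -- a maximal robust common divisor
  obtain ⟨g, hgS, hgmax⟩ := ((Finset.Icc 1 u).filter fun τ =>
    τ * (bad τ).card ≤ K * (τ - 1)).exists_max_image id ⟨1, by simp [bad]; omega⟩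
  simp only [Finset.mem_filter, Finset.mem_Icc, id] at hgS hgmax
  obtain ⟨⟨hg1, hgu⟩, hgb⟩ := hgS
  obtain ⟨hgK, hgk⟩ := hgood' g hg1 hgb
  set G := F \ bad g with hG
  have hGF : G ⊆ F := Finset.sdiff_subset
  have hGc : G.card + (bad g).card = F.card :=
    Finset.card_sdiff_add_card_eq_card (Finset.filter_subset _ _)
  have hGd : ∀ i ∈ G, ∀ b ∈ B i, (g : ℤ) ∣ b := by
    intro i hi
    rw [hG, Finset.mem_sdiff, Finset.mem_filter] at hi
    by_contra h
    exact hi.2 ⟨hi.1, h⟩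
  have hg0 : (g : ℤ) ≠ 0 := by omega
  let B' : ι → Finset ℤ := fun i => (B i).image (· / (g : ℤ))
  have hB' : ∀ i ∈ G, ∀ b, b ∈ B' i ↔ b * g ∈ B i := by
    intro i hi b
    simp only [B', Finset.mem_image]
    constructor
    · rintro ⟨c, hc, rfl⟩
      rwa [Int.ediv_mul_cancel (hGd i hi c hc)]
    · intro h
      exact ⟨_, h, Int.mul_ediv_cancel _ hg0⟩
  have hnorm : IsNormalized G B' (fun i => l i / g) k (u / g) := by
    refine ⟨?_, ?_, ?_, ?_, ?_⟩
    · intro i hi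
      simpa [hB' i hi] using hF.zero_mem i (hGF hi)
    · intro i hi b hb
      have := hF.mem_Icc i (hGF hi) _ ((hB' i hi b).1 hb)
      have hgp : (0 : ℤ) < g := by omega
      refine ⟨nonneg_of_mul_nonneg_left this.1 hgp, ?_⟩
      rw [Int.natCast_div]
      exact Int.le_ediv_of_mul_le hgp this.2
    · intro i hi
      rw [hB' i hi]
      have := hF.last_mem i (hGF hi)
      have hd := Int.natCast_dvd_natCast.1 (hGd i hi _ this)
      have : ((l i / g : ℕ) : ℤ) * g = l i := by
        exact_mod_cast Nat.div_mul_cancel hd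
      rw [this]
      exact hF.last_mem i (hGF hi)
    · intro i hi
      exact Nat.div_le_div_right (hF.le i (hGF hi))
    · intro i hi
      refine (hF.lt_card i (hGF hi)).trans_eq (Finset.card_image_of_injOn ?_).symm
      intro x hx y hy hxy
      exact Int.ediv_left_inj (hGd i hi x hx) (hGd i hi y hy) |>.1 hxy
  have hθ : ∀ p : ℕ, p.Prime → 66 * (u / g / k) ≤
      (G.filter fun i => ¬ ∀ b ∈ B' i, (p : ℤ) ∣ b).card := by
    intro p hp
    have hp2 := hp.two_le
    have hnot : ¬ g * p * (bad (g * p)).card ≤ K * (g * p - 1) := by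
      intro hcon
      have hgp : 1 ≤ g * p := Nat.mul_pos hg1 (by omega)
      have h1 := (hgood' _ hgp hcon).2
      have h2 := hgmax (g * p) ⟨⟨hgp, (Nat.le_mul_of_pos_right _ hk).trans h1⟩, hcon⟩
      nlinarith
    have hsub : bad (g * p) ⊆ bad g ∪ (G.filter fun i => ¬ ∀ b ∈ B' i, (p : ℤ) ∣ b) := by
      intro i hi
      rw [Finset.mem_filter] at hi
      by_cases hib : i ∈ bad g
      · exact Finset.mem_union_left _ hib
      · have hiG : i ∈ G := Finset.mem_sdiff.2 ⟨hi.1, hib⟩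
        refine Finset.mem_union_right _ (Finset.mem_filter.2 ⟨hiG, fun hall => hi.2 ?_⟩)
        intro b hb
        obtain ⟨c, rfl⟩ := hGd i hiG b hb
        rw [mul_comm] at hb
        push_cast
        exact mul_dvd_mul_left _ (hall c ((hB' i hiG c).2 hb))
    have hcard := (Finset.card_le_card hsub).trans (Finset.card_union_le _ _)
    set t := (G.filter fun i => ¬ ∀ b ∈ B' i, (p : ℤ) ∣ b).card
    have hgN : g * (u / g / k) ≤ M := by
      rw [hM, Nat.div_div_eq_div_mul, Nat.mul_comm g k, ← Nat.div_div_eq_div_mul]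
      exact Nat.mul_div_le _ _
    generalize u / g / k = N at *
    have hgp : 1 ≤ g * p := Nat.mul_pos hg1 (by omega)
    have h1 : K * (g * p - 1) < g * p * ((bad g).card + t) :=
      (not_le.1 hnot).trans_le (Nat.mul_le_mul_left _ hcard)
    zify [hgp, hg1] at h1 hgb hgN hp2 ⊢
    have h2 : (K : ℤ) * (p - 1) < p * (g * t) := by nlinarith
    have h3 : (p : ℤ) * K ≤ p * (2 * (g * t)) := by nlinarith
    have h4 : (K : ℤ) ≤ 2 * (g * t) := le_of_mul_le_mul_left h3 (by linarith)
    have h5 : (g : ℤ) * (66 * N) ≤ g * t := by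
      rw [hK] at h4
      push_cast at h4
      linarith
    exact le_of_mul_le_mul_left h5 (by omega)
  obtain ⟨I, hIG, a, ha⟩ := hnorm.exists_interval_subset_sum hk (N := u / g / k) (W := u)
    (by
      rw [Nat.div_div_eq_div_mul, Nat.one_le_div_iff (Nat.mul_pos hg1 hk)]
      exact hgk) rfl le_rfl hθ (Nat.div_le_self _ _) (by
      have h1 : G.card * k ≤ ∑ i ∈ G, l i / g := by
        rw [← smul_eq_mul]
        exact Finset.card_nsmul_le_sum _ _ _ fun i hi => hnorm.le_length hi
      have h2 : u < k * (M + 1) := Nat.lt_mul_div_succ u hk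
      nlinarith)
  refine ⟨I, hIG.trans hGF, a * g, g, hg1, fun j hj => ?_⟩
  have := exists_add_mul_mem_sum_of_image (B := B) (g := g) (c := fun _ => 0)
    (fun i hi b hb => by simpa using (hB' i (hIG hi) b).1 hb) (ha j hj)
  simpa [add_mul] using this


theorem exists_progression_of_card_le {ι : Type*} [DecidableEq ι] {F : Finset ι}
    {A : ι → Finset ℕ} {k u : ℕ} (hA : ∀ i ∈ F, A i ⊆ Finset.Icc 1 u)
    (hcard : ∀ i ∈ F, k + 1 ≤ (A i).card) (hk : 1 ≤ k) (hku : k ≤ u)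
    (hc : 144 * (u / k) ≤ F.card) :
    ∃ I ⊆ F, ∃ a g : ℕ, 1 ≤ g ∧ ∀ j < u, a + j * g ∈ ∑ i ∈ I, A i := by
  have hex : ∀ i ∈ F, ∃ m M : ℕ, m ∈ A i ∧ M ∈ A i ∧ ∀ x ∈ A i, m ≤ x ∧ x ≤ M := by
    intro i hi
    have hne : (A i).Nonempty := Finset.card_pos.1 (by have := hcard i hi; omega)
    exact ⟨_, _, (A i).min'_mem hne, (A i).max'_mem hne,
      fun x hx => ⟨(A i).min'_le x hx, (A i).le_max' x hx⟩⟩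
  choose! m M hm hM hmM using hex
  have hnorm : IsNormalized F (fun i => (A i).image fun x : ℕ => (x : ℤ) - m i)
      (fun i => M i - m i) k u := by
    refine ⟨fun i hi => ?_, fun i hi b hb => ?_, fun i hi => ?_, fun i hi => ?_, fun i hi => ?_⟩
    · exact Finset.mem_image.2 ⟨m i, hm i hi, sub_self _⟩
    · obtain ⟨x, hx, rfl⟩ := Finset.mem_image.1 hb
      have := hmM i hi x hx
      omega
    · have := hmM i hi _ (hM i hi)
      exact Finset.mem_image.2 ⟨M i, hM i hi, by omega⟩
    · have := Finset.mem_Icc.1 (hA i hi (hM i hi))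
      omega
    · refine (hcard i hi).trans_eq (Finset.card_image_of_injective _ fun x y hxy => ?_).symm
      simpa using hxy
  obtain ⟨I, hIF, a, g, hg, ha⟩ := hnorm.exists_progression hk hku hc
  have hcast : ∀ j < u, ∃ y ∈ ∑ i ∈ I, A i, (y : ℤ) = ∑ i ∈ I, (m i : ℤ) + (a + j * g) := by
    intro j hj
    have := exists_add_mul_mem_sum_of_image (B := fun i => (A i).image ((↑) : ℕ → ℤ)) (g := 1)
      (c := fun i => (m i : ℤ)) (fun i hi b hb => by
        obtain ⟨x, hx, rfl⟩ := Finset.mem_image.1 hb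
        exact Finset.mem_image.2 ⟨x, hx, by ring⟩) (ha j hj)
    rw [mul_one] at this
    have hmap : (∑ i ∈ I, A i).image ((↑) : ℕ → ℤ) = ∑ i ∈ I, (A i).image ((↑) : ℕ → ℤ) :=
      map_sum (Finset.imageAddMonoidHom (Nat.castAddMonoidHom ℤ)) A I
    rw [← hmap] at this
    exact Finset.mem_image.1 this
  obtain ⟨y, -, hya⟩ := hcast 0 (by omega)
  refine ⟨I, hIF, y, g, hg, fun j hj => ?_⟩
  obtain ⟨z, hz, hza⟩ := hcast j hj
  convert hz
  zify
  rw [hya, hza]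
  push_cast
  ring

/-- Sets of large total size have a sub-family whose sumset contains a long progression. -/
theorem exists_progression_of_sum_le {ι : Type*} [DecidableEq ι] {J : Finset ι}
    {A : ι → Finset ℕ} {u : ℕ} (hu : 1 ≤ u) (hA : ∀ i ∈ J, A i ⊆ Finset.Icc 1 u)
    (hJ : 144 * ∑ k ∈ Finset.Icc 1 u, u / k ≤ ∑ i ∈ J, ((A i).card - 1)) :
    ∃ I ⊆ J, ∃ a g : ℕ, 1 ≤ g ∧ ∀ j < u, a + j * g ∈ ∑ i ∈ I, A i := by
  obtain ⟨k, hk, hkc⟩ : ∃ k ∈ Finset.Icc 1 u,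
      144 * (u / k) ≤ (J.filter fun i => k ≤ (A i).card - 1).card := by
    by_contra! hlt
    have h1 := Finset.sum_lt_sum_of_nonempty ⟨1, Finset.mem_Icc.2 ⟨le_rfl, hu⟩⟩ hlt
    rw [← Finset.mul_sum] at h1
    refine (h1.trans_le hJ).ne ?_
    simp_rw [Finset.card_filter]
    rw [Finset.sum_comm]
    refine Finset.sum_congr rfl fun i hi => ?_
    rw [← Finset.card_filter]
    have hle := Finset.card_le_card (hA i hi)
    rw [Nat.card_Icc] at hle
    have : (Finset.Icc 1 u).filter (fun k => k ≤ (A i).card - 1)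
        = Finset.Icc 1 ((A i).card - 1) := by
      ext k
      simp only [Finset.mem_filter, Finset.mem_Icc]
      omega
    rw [this, Nat.card_Icc]
    omega
  rw [Finset.mem_Icc] at hk
  obtain ⟨I, hI, h⟩ := exists_progression_of_card_le
    (F := J.filter fun i => k ≤ (A i).card - 1) (A := A)
    (fun i hi => hA i (Finset.filter_subset _ _ hi))
    (fun i hi => by have := (Finset.mem_filter.1 hi).2; omega) hk.1 hk.2 hkc
  exact ⟨I, hI.trans (Finset.filter_subset _ _), h⟩

theorem sum_div_le_mul_logb {u : ℕ} (hu : 2 ≤ u) :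
    ((∑ k ∈ Finset.Icc 1 u, u / k : ℕ) : ℝ) ≤ 2 * (u * Real.logb 2 u) := by
  have hu' : (2 : ℝ) ≤ u := by exact_mod_cast hu
  have hlog2 : Real.log 2 ≤ 1 := Real.log_two_lt_d9.le.trans (by norm_num)
  have hlog2' : 0 < Real.log 2 := Real.log_pos (by norm_num)
  have h1 : (1 : ℝ) ≤ Real.logb 2 u := by
    rw [Real.le_logb_iff_rpow_le (by norm_num) (by linarith)]
    simpa using hu'
  have h2 : Real.log u ≤ Real.logb 2 u := by
    rw [← Real.log_div_log, le_div_iff₀ hlog2']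
    exact mul_le_of_le_one_right (Real.log_nonneg (by linarith)) hlog2
  have h3 : ((harmonic u : ℚ) : ℝ) = ∑ k ∈ Finset.Icc 1 u, (k : ℝ)⁻¹ := by
    rw [harmonic_eq_sum_Icc]
    push_cast
    rfl
  have h4 := harmonic_le_one_add_log u
  calc ((∑ k ∈ Finset.Icc 1 u, u / k : ℕ) : ℝ) ≤ ∑ k ∈ Finset.Icc 1 u, (u : ℝ) * (k : ℝ)⁻¹ := by
        push_cast
        exact Finset.sum_le_sum fun k _ => Nat.cast_div_le
    _ = u * (harmonic u : ℚ) := by rw [h3, Finset.mul_sum]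
    _ ≤ u * (2 * Real.logb 2 u) := mul_le_mul_of_nonneg_left (by linarith) (by linarith)
    _ = _ := by ring

theorem exists_subset_sum_le_and_mul_sum_le {ι : Type*} [DecidableEq ι] {w f : ι → ℕ} {X U r : ℕ}
    (hr : 1 ≤ r) {J : Finset ι} (hU : ∀ i ∈ J, w i ≤ U) (hJ : r * (X + U) ≤ ∑ i ∈ J, w i) :
    ∃ J' ⊆ J, X ≤ ∑ i ∈ J', w i ∧ r * ∑ i ∈ J', f i ≤ ∑ i ∈ J, f i := by
  induction r, hr using Nat.le_induction generalizing J with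
  | base => exact ⟨J, le_rfl, by omega, by simp⟩
  | succ r hr ih =>
    rw [add_mul] at hJ
    obtain ⟨G, hG, h1, h2⟩ := exists_subset_sum_between (m := X) hU (by omega)
    by_cases hf : (r + 1) * ∑ i ∈ G, f i ≤ ∑ i ∈ J, f i
    · exact ⟨G, hG, h1, hf⟩
    have hw := Finset.sum_sdiff (f := w) hG
    have hfs := Finset.sum_sdiff (f := f) hG
    obtain ⟨J', hJ', h3, h4⟩ := ih (J := J \ G) (fun i hi => hU i (Finset.sdiff_subset hi))
      (by omega)
    refine ⟨J', hJ'.trans Finset.sdiff_subset, h3, ?_⟩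
    nlinarith

/-- There is a constant `C > 0` such that: for nonempty subsets
`A 1, …, A ℓ` of `[1, u]` (with `u ≥ 1`) with weights `f`, `ρ ≥ 1`, and an integer
`u' ≥ max {u, 2}`, if `Σ |A i| ≥ ℓ + 4Cρu' log u'`, then some nonempty index set `I`
is such that the iterated sumset `Σ_{i ∈ I} A i` contains an arithmetic progression of
length at least `u'` with common difference at least `1`, and
`Σ_{i ∈ I} f i ≤ (1/ρ) Σ_i f i`. -/
theorem stmt3 : ∃ C : ℝ, 0 < C ∧
    ∀ (u ℓ : ℕ), 1 ≤ u → 0 < ℓ →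
    ∀ (A : Fin ℓ → Finset ℕ), (∀ i, (A i).Nonempty) → (∀ i, A i ⊆ Finset.Icc 1 u) →
    ∀ (f : Fin ℓ → ℕ) (ρ : ℝ), 1 ≤ ρ →
    ∀ u' : ℕ, 2 ≤ u' → u ≤ u' →
    (ℓ : ℝ) + 4 * C * ρ * (u' : ℝ) * Real.logb 2 (u' : ℝ) ≤ ∑ i, ((A i).card : ℝ) →
    ∃ I : Finset (Fin ℓ), I.Nonempty ∧
      (∃ a Δ : ℕ, 1 ≤ Δ ∧ ∀ j < u', a + j * Δ ∈ ∑ i ∈ I, A i) ∧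
      (∑ i ∈ I, (f i : ℝ)) ≤ (1 / ρ) * ∑ i, (f i : ℝ) := by
  refine ⟨288, by norm_num, ?_⟩
  intro u ℓ hu hℓ A hne hA f ρ hρ u' hu' huu' hsum
  have hA' : ∀ i, A i ⊆ Finset.Icc 1 u' := fun i =>
    (hA i).trans (Finset.Icc_subset_Icc_right huu')
  set H := ∑ k ∈ Finset.Icc 1 u', u' / k with hH
  have hH1 : u' ≤ H := by
    have := Finset.single_le_sum (f := fun k => u' / k) (fun k _ => Nat.zero_le _)
      (Finset.mem_Icc.2 ⟨le_rfl, by omega⟩ : 1 ∈ Finset.Icc 1 u')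
    simpa using this
  have hr1 : 1 ≤ ⌈ρ⌉₊ := Nat.one_le_ceil_iff.2 (by linarith)
  have hr2 : (⌈ρ⌉₊ : ℝ) ≤ 2 * ρ := by
    have := Nat.ceil_lt_add_one (show 0 ≤ ρ by linarith)
    linarith
  have hw : ∑ i, ((A i).card : ℝ) = ((∑ i, ((A i).card - 1) : ℕ) : ℝ) + ℓ := by
    have h : ∑ i, (A i).card = ∑ i, ((A i).card - 1) + ℓ := by
      calc ∑ i, (A i).card = ∑ i, ((A i).card - 1 + 1) :=
            Finset.sum_congr rfl fun i _ => (Nat.sub_add_cancel (Finset.card_pos.2 (hne i))).symm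
        _ = _ := by simp [Finset.sum_add_distrib]
    exact_mod_cast h
  have hlarge : ⌈ρ⌉₊ * (144 * H + u') ≤ ∑ i, ((A i).card - 1) := by
    have hlog := sum_div_le_mul_logb hu'
    have hH1' : (u' : ℝ) ≤ H := by exact_mod_cast hH1
    rify
    rw [← Nat.cast_sum]
    calc (⌈ρ⌉₊ : ℝ) * (144 * H + u') ≤ 2 * ρ * (288 * (2 * (u' * Real.logb 2 u'))) := by
          gcongr
          linarith
      _ = 4 * 288 * ρ * u' * Real.logb 2 u' := by ring
      _ ≤ _ := by linarith
  obtain ⟨J, -, hJ, hJf⟩ := exists_subset_sum_le_and_mul_sum_le (f := f) hr1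
    (fun i _ => by
      have := Finset.card_le_card (hA' i)
      rw [Nat.card_Icc] at this
      omega) hlarge
  obtain ⟨I, hIJ, a, g, hg, ha⟩ := exists_progression_of_sum_le (by omega) (fun i _ => hA' i) hJ
  refine ⟨I, ?_, ⟨a, g, hg, ha⟩, ?_⟩
  · by_contra hI
    rw [Finset.not_nonempty_iff_eq_empty] at hI
    have h0 := ha 0 (by omega)
    have h1 := ha 1 (by omega)
    simp only [hI, Finset.sum_empty, Finset.mem_zero] at h0 h1
    omega
  · have hIf : (∑ i ∈ I, f i) ≤ ∑ i ∈ J, f i := Finset.sum_le_sum_of_subset hIJ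
    have h : (⌈ρ⌉₊ : ℝ) * ∑ i ∈ I, (f i : ℝ) ≤ ∑ i, (f i : ℝ) := by
      exact_mod_cast (Nat.mul_le_mul_left _ hIf).trans hJf
    rw [one_div, ← div_eq_inv_mul, le_div_iff₀ (by linarith), mul_comm]
    exact (mul_le_mul_of_nonneg_right (Nat.le_ceil ρ) (by positivity)).trans h
end

section
/- There exists a constant C > 0 such that the following holds. Let u, u', k, ℓ be positive integers with u' ≥ u and k ≥ 2, and let A_1, …, A_ℓ be subsets of [1, u], each of size at least k. If ℓ·k ≥ C·u', then the sumset A_1 + A_2 + ⋯ + A_ℓ contains an arithmetic progression of length at least u' with common difference at least 1. -/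
open Pointwise

open Finset in
/-- Iterating the Dyson e-transform: inside `S + A` there is a set `S'` containing `S` that is
stable under translation by a subset `A'` of `A`, with `#S' + #A' = #S + #A`. -/
theorem exists_stable_of_zero_mem {G : Type*} [AddCommGroup G] [DecidableEq G]
    (S A : Finset G) (hA : 0 ∈ A) :
    ∃ S' A' : Finset G, S ⊆ S' ∧ A' ⊆ A ∧ S' ⊆ S + A ∧ S' + A' ⊆ S' ∧
      #S' + #A' = #S + #A := by
  induction h : #A using Nat.strong_induction_on generalizing S A with
  | _ n ih =>
    subst h
    by_cases hst : S + A ⊆ S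
    · exact ⟨S, A, subset_rfl, subset_rfl, subset_add_left _ hA, hst, rfl⟩
    obtain ⟨x, hx, hxS⟩ := not_subset.mp hst
    obtain ⟨e, he, a, ha, rfl⟩ := mem_add.mp hx
    set A₁ := {b ∈ A | e + b ∈ S} with hA₁
    set S₁ := S ∪ A.image (e + ·) with hS₁
    have hsplit : #A₁ + #{b ∈ A | e + b ∉ S} = #A := card_filter_add_card_filter_not _
    have hpos : 0 < #{b ∈ A | e + b ∉ S} := card_pos.mpr ⟨a, by simp [ha, hxS]⟩
    have hS₁card : #S₁ = #S + #{b ∈ A | e + b ∉ S} := by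
      have : S₁ = S ∪ ({b ∈ A | e + b ∉ S}).image (e + ·) := by
        ext y
        simp only [hS₁, mem_union, mem_image, mem_filter]
        constructor
        · rintro (h | ⟨b, hb, rfl⟩)
          · exact Or.inl h
          · by_cases h : e + b ∈ S
            · exact Or.inl h
            · exact Or.inr ⟨b, ⟨hb, h⟩, rfl⟩
        · rintro (h | ⟨b, ⟨hb, -⟩, rfl⟩)
          · exact Or.inl h
          · exact Or.inr ⟨b, hb, rfl⟩
      rw [this, card_union_of_disjoint, card_image_of_injective _ (add_right_injective e)]
      rw [disjoint_right]
      intro y hy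
      obtain ⟨b, hb, rfl⟩ := mem_image.mp hy
      exact (mem_filter.mp hb).2
    obtain ⟨S', A', h1, h2, h3, h4, h5⟩ :=
      ih #A₁ (by omega) S₁ A₁ (by simp [hA₁, hA, he]) rfl
    refine ⟨S', A', subset_union_left.trans h1, h2.trans (filter_subset _ _), h3.trans ?_, h4,
      by omega⟩
    intro y hy
    obtain ⟨s, hs, b, hb, rfl⟩ := mem_add.mp hy
    have hb' := mem_filter.mp hb
    rcases mem_union.mp hs with hs | hs
    · exact add_mem_add hs hb'.1
    · obtain ⟨c, hc, rfl⟩ := mem_image.mp hs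
      rw [show e + c + b = (e + b) + c by abel]
      exact add_mem_add hb'.2 hc

theorem Finset.zero_mem_sum {ι M : Type*} [AddCommMonoid M] [DecidableEq M]
    {A : ι → Finset M} {I : Finset ι} (h : ∀ i ∈ I, 0 ∈ A i) : 0 ∈ ∑ i ∈ I, A i :=
  Finset.sum_induction A (fun s => (0 : M) ∈ s)
    (fun _ _ ha hb => by simpa using Finset.add_mem_add ha hb) (by simp) h

theorem Finset.sum_subset_sum_of_zero_mem {ι M : Type*} [AddCommMonoid M] [DecidableEq M]
    {A : ι → Finset M} {I J : Finset ι} (hIJ : I ⊆ J) (h : ∀ i ∈ J, 0 ∈ A i) :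
    ∑ i ∈ I, A i ⊆ ∑ i ∈ J, A i := by
  classical
  rw [← Finset.sum_sdiff hIJ]
  exact Finset.subset_add_right _
    (Finset.zero_mem_sum fun i hi => h i (Finset.sdiff_subset hi))

open Finset in
/-- If `#J * κ ≥ 2 * #G`, the sum of sets of size at least `κ` contains a nonempty set that is
stable under a subgroup of order more than `κ / 2`. -/
theorem exists_subgroup_stable_subset_sum {ι G : Type*} [AddCommGroup G] [Fintype G]
    [DecidableEq G] (A : ι → Finset G) (J : Finset ι) (κ : ℕ)
    (h0 : ∀ i ∈ J, 0 ∈ A i) (hκ : ∀ i ∈ J, κ ≤ #(A i)) (hJ : 2 * Fintype.card G ≤ #J * κ) :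
    ∃ (H : AddSubgroup G) (P : Finset G), P.Nonempty ∧ P ⊆ ∑ i ∈ J, A i ∧
      (∀ h ∈ H, ∀ p ∈ P, h + p ∈ P) ∧ κ < 2 * Nat.card H := by
  classical
  have key : ∀ J' : Finset ι, J' ⊆ J →
      (∃ (H : AddSubgroup G) (P : Finset G), P.Nonempty ∧ P ⊆ ∑ i ∈ J', A i ∧
        (∀ h ∈ H, ∀ p ∈ P, h + p ∈ P) ∧ κ < 2 * Nat.card H) ∨
      ∃ P : Finset G, P ⊆ ∑ i ∈ J', A i ∧ 2 + #J' * κ ≤ 2 * #P := by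
    intro J'
    induction J' using Finset.induction_on with
    | empty => exact fun _ => Or.inr ⟨{0}, by simp, by simp⟩
    | insert i J' hi ih =>
      intro hsub
      have hiJ : i ∈ J := hsub (mem_insert_self _ _)
      have hsub' : J' ⊆ J := (subset_insert _ _).trans hsub
      rcases ih hsub' with ⟨H, P, hP, hPs, hst, hc⟩ | ⟨P, hPs, hc⟩
      · exact Or.inl ⟨H, P, hP, hPs.trans (sum_subset_sum_of_zero_mem (subset_insert _ _)
          fun j hj => h0 j (hsub hj)), hst, hc⟩
      obtain ⟨S', A', h1, h2, h3, h4, h5⟩ := exists_stable_of_zero_mem P (A i) (h0 i hiJ)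
      have hS' : S' ⊆ ∑ j ∈ insert i J', A j := by
        rw [sum_insert hi, add_comm]
        exact h3.trans (add_subset_add_right hPs)
      have hki := hκ i hiJ
      by_cases hA' : 2 * #A' ≤ #(A i)
      · refine Or.inr ⟨S', hS', ?_⟩
        rw [card_insert_of_notMem hi, add_mul]
        omega
      · refine Or.inl ⟨AddSubgroup.closure (A' : Set G), S', ?_, hS', ?_, ?_⟩
        · refine Nonempty.mono h1 (card_pos.mp ?_)
          omega
        · have hst : AddSubgroup.closure (A' : Set G) ≤ AddAction.stabilizer G S' := by
            rw [AddSubgroup.closure_le]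
            intro a ha
            rw [SetLike.mem_coe, AddAction.mem_stabilizer_finset']
            intro s hs
            rw [vadd_eq_add, add_comm]
            exact h4 (add_mem_add hs ha)
          intro h hh p hp
          exact AddAction.mem_stabilizer_finset'.mp (hst hh) hp
        · have : #A' ≤ Nat.card (AddSubgroup.closure (A' : Set G)) := by
            rw [← Nat.card_eq_finsetCard]
            exact Nat.card_mono (Set.toFinite _) AddSubgroup.subset_closure
          omega
  rcases key J subset_rfl with h | ⟨P, -, hP⟩
  · exact h
  · have := P.card_le_univ
    omega

open Finset in
/-- With `K` the stabilizer of `S = P + ∑ i ∈ J, B i`, every `B i` not contained in `K` adds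
at least one coset of `K` to `S`. -/
theorem card_stabilizer_mul_le_card {ι G : Type*} [AddCommGroup G] [Fintype G] [DecidableEq G]
    (P : Finset G) (hP : P.Nonempty) (B : ι → Finset G) (J : Finset ι) (h0 : ∀ i ∈ J, 0 ∈ B i)
    (bad : Finset ι) (hbad : bad ⊆ J)
    (hB : ∀ i ∈ bad, ∃ b ∈ B i, b ∉ AddAction.stabilizer G (P + ∑ i ∈ J, B i)) :
    Nat.card (AddAction.stabilizer G (P + ∑ i ∈ J, B i)) * (1 + #bad) ≤
      #(P + ∑ i ∈ J, B i) := by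
  classical
  set S := P + ∑ i ∈ J, B i with hS
  set K := AddAction.stabilizer G S with hK
  set F : Finset G := (K : Set G).toFinset with hF
  have hFmem : ∀ x, x ∈ F ↔ x ∈ K := fun x => by simp [hF]
  have hFcard : #F = Nat.card K := by
    rw [← Nat.card_eq_finsetCard]
    exact Nat.card_congr (Equiv.subtypeEquivRight hFmem)
  have hFS : F + S = S := by
    apply subset_antisymm
    · intro x hx
      obtain ⟨k, hk, s, hs, rfl⟩ := mem_add.mp hx
      exact AddAction.mem_stabilizer_finset'.mp ((hFmem k).mp hk) hs
    · exact subset_add_right _ ((hFmem 0).mpr K.zero_mem)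
  have coset : ∀ R : Finset G, ∀ x ∈ F + R, ∀ k ∈ K, k + x ∈ F + R := by
    intro R x hx k hk
    obtain ⟨f, hf, r, hr, rfl⟩ := mem_add.mp hx
    rw [← add_assoc]
    exact add_mem_add ((hFmem _).mpr (K.add_mem hk ((hFmem _).mp hf))) hr
  have key : ∀ J' : Finset ι, J' ⊆ bad →
      Nat.card K * (1 + #J') ≤ #(F + (P + ∑ i ∈ J', B i)) := by
    intro J'
    induction J' using Finset.induction_on with
    | empty =>
      intro _
      obtain ⟨p, hp⟩ := hP
      simpa [hFcard] using card_le_card_add_right (s := F) ⟨p, hp⟩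
    | insert i J' hi ih =>
      intro hsub
      have hib : i ∈ bad := hsub (mem_insert_self _ _)
      have ih := ih ((subset_insert _ _).trans hsub)
      set R := P + ∑ i ∈ J', B i with hR
      have hnew : P + ∑ j ∈ insert i J', B j = R + B i := by
        rw [sum_insert hi, hR]; abel
      rw [hnew, card_insert_of_notMem hi]
      have hle : F + R ⊆ F + (R + B i) :=
        add_subset_add_left (subset_add_left _ (h0 i (hbad hib)))
      have hnot : ¬ F + (R + B i) ⊆ F + R := by
        intro hcon
        obtain ⟨b, hb, hbK⟩ := hB i hib
        apply hbK
        have hSR : S = F + (R + B i) + ∑ j ∈ J \ insert i J', B j := by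
          rw [← hFS, hS, ← sum_sdiff (hsub.trans hbad), ← hnew]; abel
        rw [hK, AddAction.mem_stabilizer_finset']
        intro s hs
        rw [hSR] at hs ⊢
        obtain ⟨x, hx, y, hy, rfl⟩ := mem_add.mp hs
        have hx' := add_mem_add (hcon hx) hb
        rw [add_assoc] at hx'
        rw [vadd_eq_add, show b + (x + y) = (x + b) + y by abel]
        exact add_mem_add hx' hy
      obtain ⟨x, hx, hxn⟩ := not_subset.mp hnot
      have hdisj : Disjoint (F + R) (F.image (· + x)) := by
        rw [disjoint_right]
        intro y hy hyR
        obtain ⟨k, hk, rfl⟩ := mem_image.mp hy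
        have := coset R _ hyR (-k) (K.neg_mem ((hFmem k).mp hk))
        rw [neg_add_cancel_left] at this
        exact hxn this
      have hsub2 : (F + R) ∪ F.image (· + x) ⊆ F + (R + B i) := by
        apply union_subset hle
        intro y hy
        obtain ⟨k, hk, rfl⟩ := mem_image.mp hy
        exact coset _ x hx k ((hFmem k).mp hk)
      have := card_le_card hsub2
      rw [card_union_of_disjoint hdisj, card_image_of_injective _ (add_left_injective x),
        hFcard] at this
      linarith
  refine (key bad subset_rfl).trans (card_le_card ?_)
  conv_rhs => rw [← hFS]
  exact add_subset_add_left (add_subset_add_left (sum_subset_sum_of_zero_mem hbad h0))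

theorem ZMod.index_dvd_of_natCast_mem {d : ℕ} (K : AddSubgroup (ZMod d)) {a : ℕ}
    (ha : (a : ZMod d) ∈ K) : K.index ∣ a := by
  obtain ⟨g, hg⟩ := Int.subgroup_cyclic (K.comap (Int.castAddHom (ZMod d)))
  have hidx : K.index = g.natAbs := by
    rw [← K.index_comap_of_surjective (f := Int.castAddHom (ZMod d)) ZMod.intCast_surjective, hg,
      ← AddSubgroup.zmultiples_eq_closure, Int.index_zmultiples]
  have hmem : (a : ℤ) ∈ K.comap (Int.castAddHom (ZMod d)) := by simpa using ha
  rw [hg, ← AddSubgroup.zmultiples_eq_closure, Int.mem_zmultiples_iff] at hmem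
  rw [hidx]
  simpa using Int.natAbs_dvd_natAbs.mpr hmem

open Finset in
theorem card_mul_le_card_image_natCast {U d : ℕ} (hdU : d ≤ U) {A : Finset ℕ}
    (hA : A ⊆ range (U + 1)) : #A * d ≤ 2 * U * #(A.image (Nat.cast : ℕ → ZMod d)) := by
  have h := card_le_mul_card_image (f := (Nat.cast : ℕ → ZMod d)) A (U / d + 1) (by
    intro b _
    rw [← card_range (U / d + 1)]
    refine card_le_card_of_injOn (· / d) ?_ ?_
    · intro x hx
      have hx := mem_range.mp (hA (mem_filter.mp hx).1)
      simp only [coe_range, Set.mem_Iio]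
      exact Nat.lt_succ_of_le (Nat.div_le_div_right (by omega))
    · intro x hx y hy hxy
      have hmod : x % d = y % d := by
        rw [← ZMod.natCast_eq_natCast_iff', (mem_filter.mp hx).2, (mem_filter.mp hy).2]
      rw [← Nat.div_add_mod x d, ← Nat.div_add_mod y d, hmod, show x / d = y / d from hxy])
  have h2 : (U / d + 1) * d ≤ 2 * U := by
    have := Nat.div_mul_le_self U d
    linarith
  calc #A * d ≤ (U / d + 1) * #(A.image (Nat.cast : ℕ → ZMod d)) * d := Nat.mul_le_mul_right d h
    _ = (U / d + 1) * d * #(A.image (Nat.cast : ℕ → ZMod d)) := by ring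
    _ ≤ _ := Nat.mul_le_mul_right _ h2

open Finset in
theorem exists_mem_sum_modEq {ι : Type*} [DecidableEq ι] {U k d : ℕ} (hd : 0 < d) (hdU : d ≤ U)
    (A : ι → Finset ℕ) (J₁ J₂ : Finset ι) (hJ : Disjoint J₁ J₂) (h0 : ∀ i ∈ J₁ ∪ J₂, 0 ∈ A i)
    (hU : ∀ i ∈ J₁ ∪ J₂, A i ⊆ range (U + 1)) (hk : ∀ i ∈ J₁ ∪ J₂, k ≤ #(A i))
    (hJ₁ : 4 * U ≤ #J₁ * k)
    (hJ₂ : ∀ m, 2 ≤ m → m * k ≤ 4 * U → m ≤ #{i ∈ J₂ | ∃ a ∈ A i, ¬ m ∣ a}) (r : ℕ) :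
    ∃ s ∈ ∑ i ∈ J₁ ∪ J₂, A i, s ≡ r [MOD d] := by
  have : NeZero d := ⟨hd.ne'⟩
  set B : ι → Finset (ZMod d) := fun i => (A i).image Nat.cast with hB
  have hB0 : ∀ i ∈ J₁ ∪ J₂, 0 ∈ B i := fun i hi => mem_image.mpr ⟨0, h0 i hi, by simp⟩
  have hsum : ∑ i ∈ J₁ ∪ J₂, B i = (∑ i ∈ J₁ ∪ J₂, A i).image Nat.cast :=
    (map_sum (imageAddMonoidHom (Nat.castAddMonoidHom (ZMod d))) A (J₁ ∪ J₂)).symm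
  suffices h : (r : ZMod d) ∈ ∑ i ∈ J₁ ∪ J₂, B i by
    rw [hsum] at h
    obtain ⟨s, hs, hsr⟩ := mem_image.mp h
    exact ⟨s, hs, (ZMod.natCast_eq_natCast_iff _ _ _).mp hsr⟩
  have hU0 : 0 < 2 * U := by omega
  set κ := (k * d + 2 * U - 1) / (2 * U) with hκ
  have hκ1 : k * d ≤ 2 * U * κ := by
    have := Nat.lt_mul_div_succ (k * d + 2 * U - 1) hU0
    rw [← hκ, mul_add] at this
    omega
  have hκ2 : ∀ i ∈ J₁, κ ≤ #(B i) := by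
    intro i hi
    have hi := mem_union_left J₂ hi
    have h1 := card_mul_le_card_image_natCast hdU (hU i hi)
    have h2 := Nat.mul_le_mul_right d (hk i hi)
    refine Nat.lt_succ_iff.mp ((Nat.div_lt_iff_lt_mul hU0).mpr ?_)
    have : k * d ≤ 2 * U * #(B i) := h2.trans h1
    have hsucc : (#(B i)).succ * (2 * U) = 2 * U * #(B i) + 2 * U := by
      rw [Nat.succ_eq_add_one]; ring
    rw [hsucc]
    omega
  have hκ3 : 2 * Fintype.card (ZMod d) ≤ #J₁ * κ := by
    rw [ZMod.card]
    refine Nat.le_of_mul_le_mul_left ?_ hU0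
    calc 2 * U * (2 * d) = 4 * U * d := by ring
      _ ≤ #J₁ * k * d := Nat.mul_le_mul_right d hJ₁
      _ = #J₁ * (k * d) := by ring
      _ ≤ #J₁ * (2 * U * κ) := Nat.mul_le_mul_left _ hκ1
      _ = 2 * U * (#J₁ * κ) := by ring
  obtain ⟨H, P, hP, hPs, hst, hH⟩ := exists_subgroup_stable_subset_sum B J₁ κ
    (fun i hi => hB0 i (mem_union_left _ hi)) hκ2 hκ3
  have hsub : P + ∑ i ∈ J₂, B i ⊆ ∑ i ∈ J₁ ∪ J₂, B i := by
    rw [sum_union hJ]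
    exact add_subset_add_right hPs
  apply hsub
  set S := P + ∑ i ∈ J₂, B i with hS
  set K := AddAction.stabilizer (ZMod d) S with hK
  have hHK : H ≤ K := by
    intro h hh
    rw [hK, AddAction.mem_stabilizer_finset']
    intro s hs
    obtain ⟨p, hp, q, hq, rfl⟩ := mem_add.mp hs
    rw [vadd_eq_add, ← add_assoc]
    exact add_mem_add (hst h hh p hp) hq
  have hidx : K.index * Nat.card K = d := by
    rw [AddSubgroup.index_mul_card, Nat.card_zmod]
  have hcardHK : Nat.card H ≤ Nat.card K := Nat.card_mono (Set.toFinite _) hHK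
  have hSne : S.Nonempty := hP.add ⟨0, zero_mem_sum fun i hi => hB0 i (mem_union_right _ hi)⟩
  by_cases hm : K.index ≤ 1
  · have hKtop : K = ⊤ := by
      rw [← AddSubgroup.index_eq_one]
      have : K.index ≠ 0 := fun h => by rw [h, zero_mul] at hidx; omega
      omega
    obtain ⟨s, hs⟩ := hSne
    have hrK : (r : ZMod d) - s ∈ K := by rw [hKtop]; trivial
    simpa using AddAction.mem_stabilizer_finset'.mp hrK hs
  · exfalso
    have hHpos : 0 < Nat.card H := Nat.card_pos
    have hmk : K.index * k ≤ 4 * U := by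
      refine Nat.le_of_mul_le_mul_right ?_ hHpos
      calc K.index * k * Nat.card H = k * (K.index * Nat.card H) := by ring
        _ ≤ k * (K.index * Nat.card K) := by gcongr
        _ = k * d := by rw [hidx]
        _ ≤ 2 * U * κ := hκ1
        _ ≤ 2 * U * (2 * Nat.card H) := by gcongr
        _ = 4 * U * Nat.card H := by ring
    have hmbad := hJ₂ K.index (by omega) hmk
    have := card_stabilizer_mul_le_card P hP B J₂
      (fun i hi => hB0 i (mem_union_right _ hi)) {i ∈ J₂ | ∃ a ∈ A i, ¬ K.index ∣ a}
      (filter_subset _ _) (by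
        intro i hi
        obtain ⟨a, ha, hdvd⟩ := (mem_filter.mp hi).2
        exact ⟨a, mem_image_of_mem _ ha, fun hcon => hdvd (ZMod.index_dvd_of_natCast_mem K hcon)⟩)
    have hSd : #S ≤ d := by simpa using S.card_le_univ
    have hKpos : 0 < Nat.card K := Nat.card_pos
    have h3 : Nat.card K * (1 + K.index) ≤ d := by
      refine le_trans ?_ (this.trans hSd)
      gcongr
    nlinarith

open Finset in
/-- If `S` meets every residue class modulo `a`, adding `{0, a}` gains at least `a` elements. -/
theorem card_add_le_card_add {S A : Finset ℕ} {a : ℕ} (ha : 0 < a) (h0 : 0 ∈ A) (haA : a ∈ A)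
    (hS : ∀ r, ∃ s ∈ S, s ≡ r [MOD a]) : #S + a ≤ #(S + A) := by
  have hne : ∀ r, {s ∈ S | s ≡ r [MOD a]}.Nonempty := fun r => by
    obtain ⟨s, hs, hsr⟩ := hS r
    exact ⟨s, mem_filter.mpr ⟨hs, hsr⟩⟩
  set g : ℕ → ℕ := fun r => {s ∈ S | s ≡ r [MOD a]}.max' (hne r) with hg
  have hgS : ∀ r, g r ∈ S ∧ g r ≡ r [MOD a] := fun r => mem_filter.mp (max'_mem _ (hne r))
  have hinj : Set.InjOn (fun r => g r + a) (range a : Set ℕ) := by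
    intro r hr r' hr' h
    simp only [add_left_inj] at h
    have : r ≡ r' [MOD a] := (hgS r).2.symm.trans (h ▸ (hgS r').2)
    rw [Nat.ModEq, Nat.mod_eq_of_lt (by simpa using hr), Nat.mod_eq_of_lt (by simpa using hr')]
      at this
    exact this
  have hdisj : Disjoint S ((range a).image fun r => g r + a) := by
    rw [disjoint_right]
    intro y hy hyS
    obtain ⟨r, hr, rfl⟩ := mem_image.mp hy
    have hmem : g r + a ∈ {s ∈ S | s ≡ r [MOD a]} := by
      refine mem_filter.mpr ⟨hyS, ?_⟩
      simpa [Nat.ModEq] using (hgS r).2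
    have := le_max' _ _ hmem
    change g r + a ≤ g r at this
    omega
  have hsub : S ∪ (range a).image (fun r => g r + a) ⊆ S + A := by
    apply union_subset (subset_add_left _ h0)
    intro y hy
    obtain ⟨r, hr, rfl⟩ := mem_image.mp hy
    exact add_mem_add (hgS r).1 haA
  have := card_le_card hsub
  rwa [card_union_of_disjoint hdisj, card_image_of_injOn hinj, card_range] at this

open Finset in
theorem mem_add_of_card_lt_s4 {S T : Finset ℕ} {n : ℕ}
    (h : n + 1 < #{s ∈ S | s ≤ n} + #{t ∈ T | t ≤ n}) : n ∈ S + T := by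
  have hinj : Set.InjOn (fun t => n - t) ({t ∈ T | t ≤ n} : Finset ℕ) := by
    intro x hx y hy hxy
    have hx := (mem_filter.mp hx).2
    have hy := (mem_filter.mp hy).2
    simp only at hxy
    omega
  by_contra hn
  have hdisj : Disjoint {s ∈ S | s ≤ n} ({t ∈ T | t ≤ n}.image fun t => n - t) := by
    rw [disjoint_right]
    intro y hy hyS
    obtain ⟨t, ht, rfl⟩ := mem_image.mp hy
    have ht := mem_filter.mp ht
    apply hn
    have := add_mem_add (mem_filter.mp hyS).1 ht.1
    rwa [Nat.sub_add_cancel ht.2] at this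
  have hsub : {s ∈ S | s ≤ n} ∪ ({t ∈ T | t ≤ n}.image fun t => n - t) ⊆ range (n + 1) := by
    intro y hy
    simp only [mem_union, mem_filter, mem_image] at hy
    rw [mem_range]
    rcases hy with hy | ⟨t, ht, rfl⟩ <;> omega
  have := card_le_card hsub
  rw [card_union_of_disjoint hdisj, card_image_of_injOn hinj, card_range] at this
  omega

open Finset in
theorem card_le_card_filter_le_add {S : Finset ℕ} {N n : ℕ} (hS : S ⊆ range (N + 1))
    (hn : n ≤ N) : #S + n ≤ #{s ∈ S | s ≤ n} + N := by
  have h1 : #{s ∈ S | s ≤ n} + #{s ∈ S | ¬ s ≤ n} = #S := card_filter_add_card_filter_not _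
  have h2 : {s ∈ S | ¬ s ≤ n} ⊆ Ioc n N := by
    intro s hs
    have hs := mem_filter.mp hs
    have := mem_range.mp (hS hs.1)
    rw [mem_Ioc]
    omega
  have := card_le_card h2
  rw [Nat.card_Ioc] at this
  omega

open Finset in
theorem sum_subset_range {ι : Type*} {A : ι → Finset ℕ} {a : ι → ℕ} {I : Finset ι}
    (h : ∀ i ∈ I, A i ⊆ range (a i + 1)) : ∑ i ∈ I, A i ⊆ range (∑ i ∈ I, a i + 1) := by
  classical
  induction I using Finset.induction_on with
  | empty => simp [← Finset.coe_subset]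
  | insert i I hi ih =>
    rw [sum_insert hi, sum_insert hi]
    intro x hx
    obtain ⟨y, hy, z, hz, rfl⟩ := mem_add.mp hx
    have h1 := mem_range.mp (h i (mem_insert_self _ _) hy)
    have h2 := mem_range.mp (ih (fun j hj => h j (mem_insert_of_mem hj)) hz)
    rw [mem_range]
    omega

open Finset in
theorem sum_lt_card_sum {ι : Type*} [DecidableEq ι] {A : ι → Finset ℕ} {a : ι → ℕ}
    {X W : Finset ι} (hXW : Disjoint X W) (h0 : ∀ i ∈ X ∪ W, 0 ∈ A i) (ha : ∀ i ∈ W, a i ∈ A i)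
    (hpos : ∀ i ∈ W, 0 < a i) (hX : ∀ i ∈ W, ∀ r, ∃ s ∈ ∑ j ∈ X, A j, s ≡ r [MOD a i]) :
    ∑ i ∈ W, a i < #(∑ i ∈ X ∪ W, A i) := by
  induction W using Finset.induction_on with
  | empty =>
    rw [sum_empty, card_pos]
    exact ⟨0, zero_mem_sum h0⟩
  | insert i W hi ih =>
    have hsubset : X ∪ W ⊆ X ∪ insert i W := union_subset_union_right (subset_insert _ _)
    have hiX : i ∉ X := fun h => disjoint_left.mp hXW h (mem_insert_self _ _)
    have ih := ih (hXW.mono_right (subset_insert _ _)) (fun j hj => h0 j (hsubset hj))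
      (fun j hj => ha j (mem_insert_of_mem hj)) (fun j hj => hpos j (mem_insert_of_mem hj))
      (fun j hj => hX j (mem_insert_of_mem hj))
    have hii := mem_insert_self i W
    have := card_add_le_card_add (S := ∑ j ∈ X ∪ W, A j) (hpos i hii)
      (h0 i (mem_union_right _ hii)) (ha i hii) (fun r => by
        obtain ⟨s, hs, hsr⟩ := hX i hii r
        exact ⟨s, sum_subset_sum_of_zero_mem subset_union_left
          (fun j hj => h0 j (hsubset hj)) hs, hsr⟩)
    rw [sum_insert hi, union_insert, sum_insert (by simp [hi, hiX]), add_comm (A i)]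
    omega

open Finset in
/-- If the sums over `X` and over `Y` meet every residue class modulo the maxima `a i` of the
sets indexed by `W` and `Z`, the two sumsets over `X ∪ W` and `Y ∪ Z` are so dense that their
sum contains a long interval. -/
theorem mem_sum_add_sum {ι : Type*} [DecidableEq ι] {A : ι → Finset ℕ} {a : ι → ℕ}
    {X W Y Z : Finset ι} (hXW : Disjoint X W) (hYZ : Disjoint Y Z)
    (h0 : ∀ i ∈ (X ∪ W) ∪ (Y ∪ Z), 0 ∈ A i) (ha : ∀ i ∈ W ∪ Z, a i ∈ A i)
    (hpos : ∀ i ∈ W ∪ Z, 0 < a i) (hA : ∀ i ∈ (X ∪ W) ∪ (Y ∪ Z), A i ⊆ range (a i + 1))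
    (hX : ∀ i ∈ W, ∀ r, ∃ s ∈ ∑ j ∈ X, A j, s ≡ r [MOD a i])
    (hY : ∀ i ∈ Z, ∀ r, ∃ s ∈ ∑ j ∈ Y, A j, s ≡ r [MOD a i]) {n : ℕ}
    (hn : ∑ i ∈ X, a i + ∑ i ∈ Y, a i ≤ n) (hn₁ : n ≤ ∑ i ∈ X, a i + ∑ i ∈ W, a i)
    (hn₂ : n ≤ ∑ i ∈ Y, a i + ∑ i ∈ Z, a i) :
    n ∈ ∑ i ∈ X ∪ W, A i + ∑ i ∈ Y ∪ Z, A i := by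
  have h1 := sum_lt_card_sum hXW (fun i hi => h0 i (mem_union_left _ hi))
    (fun i hi => ha i (mem_union_left _ hi)) (fun i hi => hpos i (mem_union_left _ hi)) hX
  have h2 := sum_lt_card_sum hYZ (fun i hi => h0 i (mem_union_right _ hi))
    (fun i hi => ha i (mem_union_right _ hi)) (fun i hi => hpos i (mem_union_right _ hi)) hY
  have r1 := sum_subset_range (fun i hi => hA i (mem_union_left (Y ∪ Z) hi))
  have r2 := sum_subset_range (fun i hi => hA i (mem_union_right (X ∪ W) hi))
  rw [sum_union hXW (f := a)] at r1
  rw [sum_union hYZ (f := a)] at r2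
  have c1 := card_le_card_filter_le_add r1 hn₁
  have c2 := card_le_card_filter_le_add r2 hn₂
  apply mem_add_of_card_lt_s4
  omega

open Finset in
/-- A union bound: if the sets `T m` are large compared with `m`, some `12`-colouring gives every
`T m` at least `m` elements of each colour. -/
theorem exists_coloring {ι κ : Type*} [Fintype ι] [DecidableEq ι] [Fintype κ] [DecidableEq κ]
    (hκ : Fintype.card κ = 12) (N : ℕ) (T : ℕ → Finset ι)
    (hT : ∀ m, 2 ≤ m → m ≤ N → 120 * m ≤ #(T m)) :
    ∃ c : ι → κ, ∀ m, 2 ≤ m → m ≤ N → ∀ j, m ≤ #{i ∈ T m | c i = j} := by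
  by_contra hcon
  push Not at hcon
  set w : ℕ → κ → ι → κ → ℝ := fun m j i x => if i ∈ T m ∧ x = j then 1 / 2 else 1 with hw
  have hprod : ∀ m j (c : ι → κ), ∏ i, w m j i (c i) = (1 / 2) ^ #{i ∈ T m | c i = j} := by
    intro m j c
    rw [hw, prod_ite, prod_const_one, mul_one, prod_const]
    congr 2
    ext i
    simp
  have hsum : ∀ m j i, ∑ x, w m j i x = if i ∈ T m then 12 * (23 / 24 : ℝ) else 12 := by
    intro m j i
    by_cases hi : i ∈ T m
    · have : ∀ x, w m j i x = 1 - if x = j then (1 / 2 : ℝ) else 0 := by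
        intro x
        by_cases hx : x = j <;> simp [hw, hi, hx]
        norm_num
      simp only [this, sum_sub_distrib, sum_ite_eq', mem_univ, if_true, hi]
      simp [hκ]
      norm_num
    · simp [hw, hi, hκ]
  have hfix : ∀ m j, ∑ c : ι → κ, (1 / 2 : ℝ) ^ #{i ∈ T m | c i = j} =
      12 ^ Fintype.card ι * (23 / 24) ^ #(T m) := by
    intro m j
    simp only [← hprod]
    rw [← Fintype.piFinset_univ, ← prod_univ_sum]
    simp only [hsum]
    have : ∀ i, (if i ∈ T m then 12 * (23 / 24 : ℝ) else 12) =
        12 * if i ∈ T m then (23 / 24 : ℝ) else 1 := fun i => by split_ifs <;> ring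
    simp only [this, prod_mul_distrib, prod_const, card_univ, prod_ite_mem, univ_inter]
  have hbound : ∀ m ∈ Icc 2 N, (2 : ℝ) ^ m * (23 / 24) ^ #(T m) ≤ (1 / 24) ^ 2 * (1 / 2) ^ m := by
    intro m hm
    obtain ⟨h2, hN⟩ := mem_Icc.mp hm
    calc (2 : ℝ) ^ m * (23 / 24) ^ #(T m) ≤ 2 ^ m * (23 / 24) ^ (120 * m) := by
          gcongr ?_ * ?_
          exact pow_le_pow_of_le_one (by norm_num) (by norm_num) (hT m h2 hN)
      _ = (2 * (23 / 24) ^ 120) ^ m := by rw [mul_pow, ← pow_mul]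
      _ ≤ (1 / 24 * (1 / 2)) ^ m := by
          refine pow_le_pow_left₀ (by positivity) ?_ m
          norm_num
      _ = (1 / 24) ^ m * (1 / 2) ^ m := mul_pow _ _ _
      _ ≤ (1 / 24) ^ 2 * (1 / 2) ^ m := by
          gcongr ?_ * _
          exact pow_le_pow_of_le_one (by norm_num) (by norm_num) h2
  have hcount : (12 : ℝ) ^ Fintype.card ι ≤ ∑ c : ι → κ, ∑ m ∈ Icc 2 N, ∑ j : κ,
      2 ^ m * (1 / 2 : ℝ) ^ #{i ∈ T m | c i = j} := by
    have : (12 : ℝ) ^ Fintype.card ι = ∑ c : ι → κ, (1 : ℝ) := by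
      simp [hκ]
    rw [this]
    refine sum_le_sum fun c _ => ?_
    obtain ⟨m, h2, hN, j, hj⟩ := hcon c
    have h1 : (1 : ℝ) ≤ 2 ^ m * (1 / 2 : ℝ) ^ #{i ∈ T m | c i = j} := by
      calc (1 : ℝ) = 2 ^ m * (1 / 2) ^ m := by rw [← mul_pow]; norm_num
        _ ≤ _ := by
          gcongr 2 ^ m * ?_
          exact pow_le_pow_of_le_one (by norm_num) (by norm_num) hj.le
    refine h1.trans ?_
    refine le_trans ?_ (single_le_sum (f := fun m => ∑ j : κ,
      2 ^ m * (1 / 2 : ℝ) ^ #{i ∈ T m | c i = j}) (fun m _ => by positivity)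
      (mem_Icc.mpr ⟨h2, hN⟩))
    exact single_le_sum (f := fun j => 2 ^ m * (1 / 2 : ℝ) ^ #{i ∈ T m | c i = j})
      (fun j _ => by positivity) (mem_univ j)
  have hswap : ∑ c : ι → κ, ∑ m ∈ Icc 2 N, ∑ j : κ,
      2 ^ m * (1 / 2 : ℝ) ^ #{i ∈ T m | c i = j} =
      12 ^ Fintype.card ι * (12 * ∑ m ∈ Icc 2 N, (2 : ℝ) ^ m * (23 / 24) ^ #(T m)) := by
    rw [sum_comm, mul_sum, mul_sum]
    refine sum_congr rfl fun m _ => ?_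
    rw [sum_comm]
    simp only [← mul_sum, hfix, sum_const, card_univ, hκ, nsmul_eq_mul]
    push_cast
    ring
  have hsmall : 12 * ∑ m ∈ Icc 2 N, (2 : ℝ) ^ m * (23 / 24) ^ #(T m) < 1 := by
    have h1 : ∑ m ∈ Icc 2 N, (2 : ℝ) ^ m * (23 / 24) ^ #(T m) ≤
        (1 / 24) ^ 2 * ∑ m ∈ range (N + 1), (1 / 2 : ℝ) ^ m := by
      rw [mul_sum]
      refine (sum_le_sum hbound).trans
        (sum_le_sum_of_subset_of_nonneg ?_ fun m _ _ => by positivity)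
      intro m hm
      have := mem_Icc.mp hm
      rw [mem_range]
      omega
    have h2 := sum_geometric_two_le (N + 1)
    linarith
  rw [hswap] at hcount
  have hpos : (0 : ℝ) < 12 ^ Fintype.card ι := by positivity
  nlinarith

open Finset in
/-- If for every small modulus `m` many of the sets are not contained in the multiples of `m`,
the sumset contains a long interval. -/
theorem exists_interval_subset_sum {ι : Type*} [Fintype ι] [DecidableEq ι] {U u' k : ℕ}
    (hk : 2 ≤ k) (hUu : U ≤ u') (I : Finset ι) (A : ι → Finset ℕ) (h0 : ∀ i ∈ I, 0 ∈ A i)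
    (hU : ∀ i ∈ I, A i ⊆ range (U + 1)) (hcard : ∀ i ∈ I, k ≤ #(A i))
    (hI : 120 * (4 * u' / k + 2) ≤ #I)
    (hmod : ∀ m, 2 ≤ m → m ≤ 4 * U / k + 2 → 120 * m ≤ #{i ∈ I | ∃ a ∈ A i, ¬ m ∣ a}) :
    ∃ n, ∀ j < u', n + j ∈ ∑ i ∈ I, A i := by
  set T : ℕ → Finset ι := fun m =>
    if m ≤ 4 * U / k + 2 then {i ∈ I | ∃ a ∈ A i, ¬ m ∣ a} else I with hT
  have hTI : ∀ m, T m ⊆ I := by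
    intro m
    simp only [hT]
    split_ifs
    · exact filter_subset _ _
    · exact subset_rfl
  obtain ⟨c, hc⟩ := exists_coloring (κ := Fin 6 × Bool) (by simp) (4 * u' / k + 2) T (by
    intro m h2 hm
    simp only [hT]
    split_ifs with h
    · exact hmod m h2 h
    · exact le_trans (by gcongr) hI)
  set R : Fin 6 → Bool → Finset ι := fun j b => {i ∈ I | c i = (j, b)} with hR
  set Q : Fin 6 → Finset ι := fun j => {i ∈ I | (c i).1 = j} with hQ
  have hRQ : ∀ j, R j true ∪ R j false = Q j := by
    intro j
    ext i
    simp only [hR, hQ, mem_union, mem_filter, Prod.ext_iff]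
    cases (c i).2 <;> simp
  have hRdisj : ∀ j, Disjoint (R j true) (R j false) := by
    intro j
    rw [disjoint_left]
    intro i hi hi'
    have h1 := (mem_filter.mp hi).2
    have h2 := (mem_filter.mp hi').2
    rw [h1] at h2
    simp at h2
  have hQI : ∀ j, Q j ⊆ I := fun j => filter_subset _ _
  have hRcard : ∀ j b, 4 * u' / k + 2 ≤ #(R j b) := fun j b =>
    (hc _ (Nat.le_add_left 2 _) le_rfl (j, b)).trans (card_le_card (filter_subset_filter _ (hTI _)))
  have hkpos : 0 < k := by omega
  have hdiv : ∀ x, 4 * x ≤ (4 * x / k + 2) * k := by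
    intro x
    have := Nat.lt_mul_div_succ (4 * x) hkpos
    nlinarith
  have hmono : 4 * U / k ≤ 4 * u' / k := Nat.div_le_div_right (by omega)
  have hfill : ∀ j d, 0 < d → d ≤ U → ∀ r, ∃ s ∈ ∑ i ∈ Q j, A i, s ≡ r [MOD d] := by
    intro j d hd hdU r
    rw [← hRQ]
    have hsub : ∀ i ∈ R j true ∪ R j false, i ∈ I := fun i hi => hQI j (hRQ j ▸ hi)
    refine exists_mem_sum_modEq hd hdU A _ _ (hRdisj j) (fun i hi => h0 i (hsub i hi))
      (fun i hi => hU i (hsub i hi)) (fun i hi => hcard i (hsub i hi)) ?_ ?_ r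
    · calc 4 * U ≤ 4 * u' := by omega
        _ ≤ (4 * u' / k + 2) * k := hdiv u'
        _ ≤ _ := Nat.mul_le_mul_right k (hRcard j true)
    · intro m h2 hm
      have hm' : m ≤ 4 * U / k := (Nat.le_div_iff_mul_le hkpos).mpr hm
      refine (hc m h2 (by omega) (j, false)).trans (card_le_card ?_)
      intro i hi
      have hi := mem_filter.mp hi
      simp only [hT, if_pos (show m ≤ 4 * U / k + 2 by omega)] at hi
      have hi1 := mem_filter.mp hi.1
      exact mem_filter.mpr ⟨mem_filter.mpr ⟨hi1.1, hi.2⟩, hi1.2⟩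
  set a : ι → ℕ := fun i => (A i).sup id with ha
  have haA : ∀ i ∈ I, a i ∈ A i := fun i hi => by
    obtain ⟨x, hx, hxa⟩ := exists_mem_eq_sup (A i) ⟨0, h0 i hi⟩ id
    rw [ha]
    simp only [hxa]
    exact hx
  have hAa : ∀ i ∈ I, A i ⊆ range (a i + 1) := fun i _ x hx =>
    mem_range.mpr (Nat.lt_succ_of_le (le_sup (f := id) hx))
  have hak : ∀ i ∈ I, k ≤ a i + 1 := fun i hi => by
    simpa using (hcard i hi).trans (card_le_card (hAa i hi))
  have haU : ∀ i ∈ I, a i ≤ U := fun i hi =>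
    Nat.lt_succ_iff.mp (mem_range.mp (hU i hi (haA i hi)))
  set σ : Fin 6 → ℕ := fun j => ∑ i ∈ Q j, a i with hσ
  have hσu : ∀ j, u' ≤ σ j := by
    intro j
    have h1 : #(Q j) * (k - 1) ≤ σ j := by
      rw [hσ, ← smul_eq_mul]
      exact card_nsmul_le_sum _ _ _ fun i hi => by
        have := hak i (hQI j hi)
        omega
    have h2 : 4 * u' / k + 2 ≤ #(Q j) :=
      (hRcard j true).trans (card_le_card (hRQ j ▸ subset_union_left))
    have h3 := hdiv u'
    have h4 := Nat.mul_le_mul_right (k - 1) h2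
    have h5 : (4 * u' / k + 2) * k ≤ (4 * u' / k + 2) * (2 * (k - 1)) := by
      gcongr
      omega
    nlinarith
  set e := Tuple.sort σ with he
  have hsort : ∀ s t : Fin 6, s ≤ t → σ (e s) ≤ σ (e t) := fun s t hst =>
    Tuple.monotone_sort σ hst
  have hdisj : ∀ s t : Fin 6, s ≠ t → Disjoint (Q (e s)) (Q (e t)) := by
    intro s t hst
    rw [disjoint_left]
    intro i hi hi'
    exact hst (e.injective ((mem_filter.mp hi).2.symm.trans (mem_filter.mp hi').2))
  set X := Q (e 0) with hX
  set Y := Q (e 1) with hY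
  set W := Q (e 2) ∪ Q (e 3) with hW
  set Z := Q (e 4) ∪ Q (e 5) with hZ
  have hXI : X ⊆ I := hQI _
  have hYI : Y ⊆ I := hQI _
  have hWI : W ⊆ I := union_subset (hQI _) (hQI _)
  have hZI : Z ⊆ I := union_subset (hQI _) (hQI _)
  have hXW : Disjoint X W := disjoint_union_right.mpr
    ⟨hdisj _ _ (by decide), hdisj _ _ (by decide)⟩
  have hYZ : Disjoint Y Z := disjoint_union_right.mpr
    ⟨hdisj _ _ (by decide), hdisj _ _ (by decide)⟩
  have hXWYZ : Disjoint (X ∪ W) (Y ∪ Z) := by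
    simp only [hX, hY, hW, hZ, disjoint_union_left, disjoint_union_right]
    refine ⟨⟨?_, ?_, ?_⟩, ⟨?_, ?_, ?_⟩⟩ <;> (try constructorm* _ ∧ _) <;> exact hdisj _ _ (by decide)
  have hsubI : (X ∪ W) ∪ (Y ∪ Z) ⊆ I :=
    union_subset (union_subset hXI hWI) (union_subset hYI hZI)
  have hWZI : W ∪ Z ⊆ I := union_subset hWI hZI
  have hapos : ∀ i ∈ I, 0 < a i := fun i hi => by
    have := hak i hi
    omega
  have hσW : ∑ i ∈ W, a i = σ (e 2) + σ (e 3) := sum_union (hdisj _ _ (by decide))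
  have hσZ : ∑ i ∈ Z, a i = σ (e 4) + σ (e 5) := sum_union (hdisj _ _ (by decide))
  have hσX : ∑ i ∈ X, a i = σ (e 0) := rfl
  have hσY : ∑ i ∈ Y, a i = σ (e 1) := rfl
  refine ⟨σ (e 0) + σ (e 1), fun j hj => ?_⟩
  refine sum_subset_sum_of_zero_mem hsubI h0 ?_
  rw [sum_union hXWYZ]
  have h12 := hsort 1 2 (by decide)
  have h04 := hsort 0 4 (by decide)
  have h3 := hσu (e 3)
  have h5 := hσu (e 5)
  exact mem_sum_add_sum hXW hYZ (fun i hi => h0 i (hsubI hi)) (fun i hi => haA i (hWZI hi))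
    (fun i hi => hapos i (hWZI hi)) (fun i hi => hAa i (hsubI hi))
    (fun i hi => hfill _ _ (hapos i (hWI hi)) (haU i (hWI hi)))
    (fun i hi => hfill _ _ (hapos i (hZI hi)) (haU i (hZI hi)))
    (by omega) (by omega) (by omega)

open Finset in
theorem exists_arithmeticProgression_subset_sum {ι : Type*} [Fintype ι] [DecidableEq ι] {u' k : ℕ}
    (hk : 2 ≤ k) (hu' : 0 < u') (U : ℕ) (hUu : U < u') (I : Finset ι) (A : ι → Finset ℕ)
    (h0 : ∀ i ∈ I, 0 ∈ A i) (hU : ∀ i ∈ I, A i ⊆ range (U + 1)) (hcard : ∀ i ∈ I, k ≤ #(A i))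
    (hI : 960 * u' + 1920 * U ≤ #I * k) :
    ∃ a Δ : ℕ, 1 ≤ Δ ∧ ∀ j < u', a + j * Δ ∈ ∑ i ∈ I, A i := by
  induction U using Nat.strong_induction_on generalizing I A with
  | _ U ih =>
  have hIpos : 0 < #I := Nat.pos_of_ne_zero fun h => by
    rw [h] at hI
    omega
  have hkU : k ≤ U + 1 := by
    obtain ⟨i, hi⟩ := card_pos.mp hIpos
    simpa using (hcard i hi).trans (card_le_card (hU i hi))
  by_cases hmod : ∀ m, 2 ≤ m → m ≤ 4 * U / k + 2 →
      120 * m ≤ #{i ∈ I | ∃ a ∈ A i, ¬ m ∣ a}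
  · obtain ⟨n, hn⟩ := exists_interval_subset_sum hk hUu.le I A h0 hU hcard (by
      refine Nat.le_of_mul_le_mul_right ?_ (show 0 < k by omega)
      have := Nat.div_mul_le_self (4 * u') k
      calc 120 * (4 * u' / k + 2) * k = 120 * (4 * u' / k * k) + 240 * k := by ring
        _ ≤ #I * k := by omega) hmod
    exact ⟨n, 1, le_rfl, fun j hj => by simpa using hn j hj⟩
  · push Not at hmod
    obtain ⟨m, h2, hm, hlt⟩ := hmod
    set I' := {i ∈ I | ¬ ∃ a ∈ A i, ¬ m ∣ a} with hI'
    have hI'I : I' ⊆ I := filter_subset _ _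
    have hcI : #{i ∈ I | ∃ a ∈ A i, ¬ m ∣ a} + #I' = #I := card_filter_add_card_filter_not _
    have hdvd : ∀ i ∈ I', ∀ a ∈ A i, m ∣ a := fun i hi => by
      have := (mem_filter.mp hi).2
      push Not at this
      exact this
    have hmk : m * k ≤ 8 * U := by
      have := Nat.div_mul_le_self (4 * U) k
      calc m * k ≤ (4 * U / k + 2) * k := Nat.mul_le_mul_right k hm
        _ = 4 * U / k * k + 2 * k := by ring
        _ ≤ 8 * U := by omega
    have hhalf : U / m ≤ U / 2 := Nat.div_le_div_left h2 (by omega)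
    have hI'k : 960 * u' + 1920 * (U / m) ≤ #I' * k := by
      have h3 := Nat.mul_le_mul_right k hlt.le
      have h4 : #I * k = #{i ∈ I | ∃ a ∈ A i, ¬ m ∣ a} * k + #I' * k := by rw [← hcI, add_mul]
      have h5 : 120 * m * k = 120 * (m * k) := by ring
      omega
    set A' : ι → Finset ℕ := fun i => (A i).image (· / m) with hA'
    have hmul : ∀ i ∈ I', (A' i).image (m * ·) = A i := by
      intro i hi
      rw [hA', image_image]
      ext x
      simp only [mem_image, Function.comp]
      constructor
      · rintro ⟨y, hy, rfl⟩
        rwa [Nat.mul_div_cancel' (hdvd i hi y hy)]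
      · exact fun hx => ⟨x, hx, Nat.mul_div_cancel' (hdvd i hi x hx)⟩
    obtain ⟨a, Δ, hΔ, hap⟩ := ih (U / m) (by omega) (by omega) I' A'
      (fun i hi => mem_image.mpr ⟨0, h0 i (hI'I hi), by simp⟩) (by
        intro i hi y hy
        obtain ⟨x, hx, rfl⟩ := mem_image.mp hy
        have := mem_range.mp (hU i (hI'I hi) hx)
        exact mem_range.mpr (Nat.lt_succ_of_le (Nat.div_le_div_right (by omega))))
      (fun i hi => (hcard i (hI'I hi)).trans (by
        rw [← hmul i hi]
        exact card_image_le)) hI'k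
    refine ⟨m * a, m * Δ, Nat.mul_pos (by omega) hΔ, fun j hj => ?_⟩
    refine sum_subset_sum_of_zero_mem hI'I h0 ?_
    have hsum : ∑ i ∈ I', A i = (∑ i ∈ I', A' i).image (m * ·) := by
      rw [← sum_congr rfl hmul]
      exact (map_sum (imageAddMonoidHom (AddMonoidHom.mulLeft m)) A' I').symm
    rw [hsum]
    exact mem_image.mpr ⟨_, hap j hj, by ring⟩


/-- There is a constant `C > 0` such that: for positive integers
`u, u', k, ℓ` with `u' ≥ u` and `k ≥ 2`, and subsets `A 1, …, A ℓ` of `[1, u]` each of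
size at least `k`, if `ℓ·k ≥ C·u'` then the sumset `A 1 + ⋯ + A ℓ` contains an
arithmetic progression of length at least `u'` with common difference at least `1`. -/
theorem stmt4 : ∃ C : ℝ, 0 < C ∧
    ∀ (u u' k ℓ : ℕ), 0 < u → 0 < u' → 0 < k → 0 < ℓ → u ≤ u' → 2 ≤ k →
    ∀ A : Fin ℓ → Finset ℕ, (∀ i, A i ⊆ Finset.Icc 1 u) → (∀ i, k ≤ (A i).card) →
    C * (u' : ℝ) ≤ (ℓ : ℝ) * (k : ℝ) →
    ∃ a Δ : ℕ, 1 ≤ Δ ∧ ∀ j < u', a + j * Δ ∈ ∑ i, A i := by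
  refine ⟨2880, by norm_num, ?_⟩
  intro u u' k ℓ hu hu' _ _ huu hk A hA hcard hC
  have hC' : 2880 * u' ≤ ℓ * k := by exact_mod_cast hC
  have hne : ∀ i, (A i).Nonempty := fun i => Finset.card_pos.mp (by have := hcard i; omega)
  set b : Fin ℓ → ℕ := fun i => (A i).min' (hne i) with hb
  have hbA : ∀ i, b i ∈ A i := fun i => Finset.min'_mem _ _
  have hle : ∀ i, ∀ x ∈ A i, b i ≤ x := fun i x hx => Finset.min'_le _ _ hx
  set A' : Fin ℓ → Finset ℕ := fun i => (A i).image (· - b i) with hA'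
  have hshift : ∀ i, A i = {b i} + A' i := by
    intro i
    ext x
    simp only [Finset.mem_add, Finset.mem_singleton, hA', Finset.mem_image]
    constructor
    · exact fun hx => ⟨b i, rfl, _, ⟨x, hx, rfl⟩, Nat.add_sub_cancel' (hle i x hx)⟩
    · rintro ⟨_, rfl, _, ⟨y, hy, rfl⟩, rfl⟩
      rwa [Nat.add_sub_cancel' (hle i y hy)]
  obtain ⟨a, Δ, hΔ, hap⟩ := exists_arithmeticProgression_subset_sum hk hu' (u - 1) (by omega)
    Finset.univ A' (fun i _ => Finset.mem_image.mpr ⟨b i, hbA i, by simp⟩) (by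
      intro i _ y hy
      obtain ⟨x, hx, rfl⟩ := Finset.mem_image.mp hy
      have h1 := Finset.mem_Icc.mp (hA i hx)
      have h2 := Finset.mem_Icc.mp (hA i (hbA i))
      rw [Finset.mem_range]
      omega)
    (fun i _ => by
      have h := hcard i
      rw [hshift i] at h
      simpa using h.trans Finset.card_add_le)
    (by
      rw [Finset.card_univ, Fintype.card_fin]
      omega)
  refine ⟨∑ i, b i + a, Δ, hΔ, fun j hj => ?_⟩
  have hsum : ∑ i, A i = {∑ i, b i} + ∑ i, A' i := by
    rw [Finset.sum_congr rfl fun i _ => hshift i, Finset.sum_add_distrib]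
    congr 1
    exact (map_sum (Finset.singletonAddMonoidHom (α := ℕ)) b Finset.univ).symm
  rw [hsum, add_assoc]
  exact Finset.add_mem_add (Finset.mem_singleton_self _) (hap j hj)
end

section
/- Let w ≥ 2, t, and d be positive integers with t ≥ 10√(wt)·log w, and let R and D be finite multi-sets of integers from [1, w] such that every element of R ∪ D is divisible by d. Suppose: (a) σ(R) ≤ 4√(wt)·log w; (b) for every integer b with 1 ≤ b ≤ √(t/w), S(R/d) mod b = [0, b−1]; and (c) there is a subset P ⊆ D such that S(P/d) contains an arithmetic progression of length k ≥ 5√(wt)·log w with common difference Δ ≥ 1 and last term a_k ≤ t/(2d), and σ(D) − σ(P) ≥ t. Then every multiple of d lying in the interval [t − √(wt)·log w, t] belongs to S(R ∪ D). -/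
/-- The set of all subset sums of a multiset of natural numbers. -/
def subsetSums (Z : Multiset ℕ) : Set ℕ := {s | ∃ Y ≤ Z, Y.sum = s}

/-- If every element of `Z` is divisible by `d`, then subset sums of `Z / d` scale up to subset sums
of `Z`. -/
theorem mul_mem_subsetSums_of_mem_map_div {d : ℕ} {Z : Multiset ℕ} (hZ : ∀ x ∈ Z, d ∣ x) {s : ℕ}
    (hs : s ∈ subsetSums (Z.map (· / d))) : d * s ∈ subsetSums Z := by
  induction Z using Multiset.induction generalizing s with
  | empty =>
    obtain ⟨Y, hY, rfl⟩ := hs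
    rw [Multiset.map_zero, Multiset.le_zero] at hY
    exact ⟨0, le_rfl, by simp [hY]⟩
  | cons x Z ih =>
    obtain ⟨Y, hY, rfl⟩ := hs
    rw [Multiset.map_cons] at hY
    have hZ' : ∀ z ∈ Z, d ∣ z := fun z hz => hZ z (Multiset.mem_cons_of_mem hz)
    by_cases hx : x / d ∈ Y
    · obtain ⟨Y', rfl⟩ := Multiset.exists_cons_of_mem hx
      obtain ⟨V, hV, hVs⟩ := ih hZ' ⟨Y', (Multiset.cons_le_cons_iff _).1 hY, rfl⟩
      refine ⟨x ::ₘ V, (Multiset.cons_le_cons_iff _).2 hV, ?_⟩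
      rw [Multiset.sum_cons, Multiset.sum_cons, hVs, mul_add,
        Nat.mul_div_cancel' (hZ x (Multiset.mem_cons_self x Z))]
    · obtain ⟨V, hV, hVs⟩ := ih hZ' ⟨Y, (Multiset.le_cons_of_notMem hx).1 hY, rfl⟩
      exact ⟨V, hV.trans (Multiset.le_cons_self Z x), hVs⟩

theorem add_mem_subsetSums {A B : Multiset ℕ} {a b : ℕ} (ha : a ∈ subsetSums A)
    (hb : b ∈ subsetSums B) : a + b ∈ subsetSums (A + B) := by
  obtain ⟨U, hU, rfl⟩ := ha
  obtain ⟨V, hV, rfl⟩ := hb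
  exact ⟨U + V, add_le_add hU hV, Multiset.sum_add U V⟩

theorem le_sum_of_mem_subsetSums {Z : Multiset ℕ} {s : ℕ} (hs : s ∈ subsetSums Z) :
    s ≤ Z.sum := by
  obtain ⟨Y, hY, rfl⟩ := hs
  rw [← add_tsub_cancel_of_le hY, Multiset.sum_add]
  exact Nat.le_add_right _ _

theorem dvd_of_mem_subsetSums {d : ℕ} {Z : Multiset ℕ} (hZ : ∀ x ∈ Z, d ∣ x) {s : ℕ}
    (hs : s ∈ subsetSums Z) : d ∣ s := by
  obtain ⟨Y, hY, rfl⟩ := hs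
  exact Multiset.dvd_sum fun x hx => hZ x (Multiset.mem_of_le hY hx)

/-- Greedy choice: subset sums of a multiset with elements at most `w` have gaps at most `w`. -/
theorem exists_mem_subsetSums_between {w : ℕ} {E : Multiset ℕ} (hE : ∀ x ∈ E, x ≤ w) {m : ℕ}
    (hm : m ≤ E.sum) : ∃ g ∈ subsetSums E, m ≤ g ∧ g ≤ m + w := by
  induction E using Multiset.induction with
  | empty => exact ⟨0, ⟨0, le_rfl, rfl⟩, by simpa using hm, Nat.zero_le _⟩
  | cons x E ih =>
    by_cases h : m ≤ E.sum
    · obtain ⟨g, ⟨G, hG, hGs⟩, hg⟩ := ih (fun z hz => hE z (Multiset.mem_cons_of_mem hz)) h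
      exact ⟨g, ⟨G, hG.trans (Multiset.le_cons_self E x), hGs⟩, hg⟩
    · refine ⟨_, ⟨x ::ₘ E, le_rfl, rfl⟩, hm, ?_⟩
      have := hE x (Multiset.mem_cons_self x E)
      rw [Multiset.sum_cons]
      omega

/-- Combining a complete residue system modulo `Δ` (from `R`), an arithmetic progression with
difference `Δ` (from `P`) and a greedy filling (from `E`). -/
theorem mem_subsetSums_of_residues_of_progression {w d a Δ n y : ℕ} {R P E : Multiset ℕ}
    (hd : 0 < d) (hΔ : 1 ≤ Δ) (hRd : ∀ x ∈ R, d ∣ x) (hPd : ∀ x ∈ P, d ∣ x)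
    (hEd : ∀ x ∈ E, d ∣ x) (hEw : ∀ x ∈ E, x ≤ w)
    (hmod : ∀ i < Δ, ∃ r ∈ subsetSums (R.map (· / d)), r % Δ = i)
    (hprog : ∀ j ≤ n, a + j * Δ ∈ subsetSums (P.map (· / d)))
    (hy : d ∣ y) (hlow : d * (a + n * Δ) ≤ y) (hyE : y ≤ E.sum)
    (hlong : R.sum + w ≤ n * Δ) : y ∈ subsetSums (R + P + E) := by
  obtain ⟨q, rfl⟩ := hy
  obtain ⟨g, hgE, hg1, hg2⟩ :=
    exists_mem_subsetSums_between hEw (m := d * q - d * (a + n * Δ)) (by omega)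
  obtain ⟨e, rfl⟩ := dvd_of_mem_subsetSums hEd hgE
  obtain ⟨r, hrR, hr⟩ := hmod ((q - e - a) % Δ) (Nat.mod_lt _ hΔ)
  have hdr := mul_mem_subsetSums_of_mem_map_div hRd hrR
  have hrs := le_sum_of_mem_subsetSums hdr
  have hn : n * Δ ≤ d * (n * Δ) := Nat.le_mul_of_pos_left _ hd
  have hupper : e + a + r ≤ q := by
    refine Nat.le_of_mul_le_mul_left ?_ hd
    rw [mul_add] at hg1 hg2 hlow
    rw [mul_add, mul_add]
    omega
  have hlower : q ≤ e + (a + n * Δ) := by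
    refine Nat.le_of_mul_le_mul_left ?_ hd
    rw [mul_add]
    omega
  obtain ⟨j, hj⟩ := (Nat.modEq_iff_dvd' (by omega)).1 (show r ≡ q - e - a [MOD Δ] from hr)
  have hjn : j ≤ n := by
    refine Nat.le_of_mul_le_mul_left ?_ hΔ
    rw [← hj, mul_comm Δ n]
    omega
  have hsum : d * q = d * r + d * (a + j * Δ) + d * e := by
    rw [← mul_add, ← mul_add, mul_comm j Δ, ← hj]
    congr 1
    omega
  rw [hsum]
  exact add_mem_subsetSums (add_mem_subsetSums hdr
    (mul_mem_subsetSums_of_mem_map_div hPd (hprog j hjn))) hgE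

/-- Let `w ≥ 2`, `t, d ≥ 1` with `t ≥ 10√(wt) log w`, and let `R, D`
be multisets of integers from `[1, w]` all of whose elements are divisible by `d`.
Suppose (a) `σ(R) ≤ 4√(wt) log w`; (b) for every integer `1 ≤ b ≤ √(t/w)`, every residue
modulo `b` is realized by some subset sum of `R/d`; and (c) some subset `P ⊆ D` is such
that `S(P/d)` contains an arithmetic progression of length `k ≥ 5√(wt) log w` with
common difference `Δ ≥ 1` and last term at most `t/(2d)`, and `σ(D) − σ(P) ≥ t`.
Then every multiple of `d` in `[t − √(wt) log w, t]` belongs to `S(R ∪ D)`. -/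
theorem stmt13 (w t d : ℕ) (hw : 2 ≤ w) (ht : 0 < t) (hd : 0 < d)
    (htlarge : 10 * Real.sqrt (w * t) * Real.logb 2 w ≤ (t : ℝ))
    (R D : Multiset ℕ)
    (hR : ∀ x ∈ R, x ∈ Finset.Icc 1 w) (hD : ∀ x ∈ D, x ∈ Finset.Icc 1 w)
    (hdiv : ∀ x ∈ R + D, d ∣ x)
    (hRsum : (R.sum : ℝ) ≤ 4 * Real.sqrt (w * t) * Real.logb 2 w)
    (hmod : ∀ b : ℕ, 1 ≤ b → (b : ℝ) ≤ Real.sqrt ((t : ℝ) / (w : ℝ)) →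
      (fun s => s % b) '' subsetSums (R.map (· / d)) = Set.Iio b)
    (hP : ∃ P ≤ D, ∃ a Δ k : ℕ, 1 ≤ Δ ∧
      5 * Real.sqrt (w * t) * Real.logb 2 w ≤ (k : ℝ) ∧
      (∀ j < k, a + j * Δ ∈ subsetSums (P.map (· / d))) ∧
      ((a + (k - 1) * Δ : ℕ) : ℝ) ≤ (t : ℝ) / (2 * d) ∧
      P.sum + t ≤ D.sum) :
    ∀ y : ℕ, d ∣ y → (t : ℝ) - Real.sqrt (w * t) * Real.logb 2 w ≤ (y : ℝ) → y ≤ t →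
      y ∈ subsetSums (R + D) := by
  obtain ⟨P, hPD, a, Δ, k, hΔ, hk, hprog, hlast, hPsum⟩ := hP
  intro y hdy hylow hyt
  set s := Real.sqrt (w * t) with hs
  set l := Real.logb 2 w with hl
  have hw2 : (2 : ℝ) ≤ w := by exact_mod_cast hw
  have ht0 : (0 : ℝ) < t := by exact_mod_cast ht
  have hd1 : (1 : ℝ) ≤ d := by exact_mod_cast hd
  have hΔ1 : (1 : ℝ) ≤ Δ := by exact_mod_cast hΔ
  have hl1 : 1 ≤ l := by
    rw [hl, Real.le_logb_iff_rpow_le one_lt_two (by linarith)]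
    simpa using hw2
  have hs0 : 0 < s := Real.sqrt_pos.2 (by positivity)
  have hss : s * s = w * t := Real.mul_self_sqrt (by positivity)
  have hsl : s ≤ s * l := le_mul_of_one_le_right hs0.le hl1
  have hsw : 10 * w ≤ s := by
    refine le_of_mul_le_mul_right ?_ hs0
    nlinarith
  have hk1 : 1 ≤ k := by
    have : (0 : ℝ) < k := by nlinarith
    exact_mod_cast this
  obtain ⟨n, rfl⟩ := Nat.exists_eq_add_of_le' hk1
  rw [Nat.add_sub_cancel, le_div_iff₀ (by positivity)] at hlast
  push_cast at hk hlast
  have hlast' : (d : ℝ) * (a + n * Δ) ≤ t / 2 := by linarith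
  have hnL : 4 * s * l + w ≤ n := by nlinarith
  have hnΔ : (n : ℝ) ≤ n * Δ := le_mul_of_one_le_right n.cast_nonneg hΔ1
  have hΔn : s * Δ ≤ t := by
    have h1 : (n : ℝ) * Δ ≤ d * (a + n * Δ) := by
      have : (0 : ℝ) ≤ a := a.cast_nonneg
      have : (0 : ℝ) ≤ n * Δ := by positivity
      nlinarith
    have h2 : s * Δ ≤ n * Δ := mul_le_mul_of_nonneg_right (by nlinarith) (by linarith)
    linarith
  have hΔsqrt : (Δ : ℝ) ≤ Real.sqrt ((t : ℝ) / w) := by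
    rw [Real.le_sqrt' (by linarith), le_div_iff₀ (by linarith)]
    refine le_of_mul_le_mul_right ?_ ht0
    calc (Δ : ℝ) ^ 2 * w * t = (s * Δ) * (s * Δ) := by linear_combination -(Δ : ℝ) ^ 2 * hss
      _ ≤ t * t := mul_self_le_mul_self (by positivity) hΔn
  have hRP : R + D = R + P + (D - P) := by
    rw [add_assoc, add_tsub_cancel_of_le hPD]
  have hDsum : P.sum + (D - P).sum = D.sum := by
    rw [← Multiset.sum_add, add_tsub_cancel_of_le hPD]
  have hDd : ∀ x ∈ D, d ∣ x := fun x hx => hdiv x (Multiset.mem_add.2 (Or.inr hx))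
  have hsub : ∀ x ∈ D - P, x ∈ D := fun x hx => Multiset.mem_of_le tsub_le_self hx
  rw [hRP]
  refine mem_subsetSums_of_residues_of_progression (w := w) (a := a) (n := n) hd hΔ
    (fun x hx => hdiv x (Multiset.mem_add.2 (Or.inl hx)))
    (fun x hx => hDd x (Multiset.mem_of_le hPD hx)) (fun x hx => hDd x (hsub x hx))
    (fun x hx => (Finset.mem_Icc.1 (hD x (hsub x hx))).2) (fun i hi => ?_)
    (fun j hj => hprog j (Nat.lt_succ_of_le hj)) hdy ?_ (by omega) ?_
  · exact (hmod Δ hΔ hΔsqrt).ge hi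
  · have : (d : ℝ) * (a + n * Δ) ≤ y := by linarith
    exact_mod_cast this
  · have : (R.sum : ℝ) + w ≤ n * Δ := by linarith
    exact_mod_cast this
end
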